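/- There exist δ₀ = δ₀(ρ) > 0 and C = C(ρ) > 0 such that for every 0 < δ ≤ δ₀, every even l ∈ [2, l_max], and every y ∈ 𝒰^l_δ with associated configuration ȳ ∈ 𝒰^l: E^red_{l+1}(y) − (l−1) e_cell ≥ C (|y_{l+1} − y₁| − |ȳ_{l+1} − ȳ₁|)²₊ ≥ C (|y_{l+1} − y₁| − l Λ(l))²₊, where (a)²₊ = (max{a, 0})². -/

import Mathlib

open Real

attribute [local instance] Classical.propDecidable

noncomputable section

/-- Counterclockwise angle from `a` to `b`, in `[0, 2π)`. -/
def ccwAngle (a b : ℂ) : ℝ :=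
  if Complex.arg (b * (starRingEnd ℂ) a) < 0 then
    Complex.arg (b * (starRingEnd ℂ) a) + 2 * π
  else Complex.arg (b * (starRingEnd ℂ) a)

/-- Bond length `b_i`. -/
def bnd (y : ℕ → ℂ) (i : ℕ) : ℝ := ‖y (i + 1) - y i‖

/-- Bond angle `φ_i = ∡(y_{i-1} − y_i, y_{i+1} − y_i)`. -/
def ang (y : ℕ → ℂ) (i : ℕ) : ℝ := ccwAngle (y (i - 1) - y i) (y (i + 1) - y i)

/-- Admissible configurations `𝒜_n` (atoms indexed `1,…,n`). -/
def Admissible (n : ℕ) (y : ℕ → ℂ) : Prop :=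
  (∀ i j : ℕ, 1 ≤ i → i ≤ n → 1 ≤ j → j ≤ n → (i + 2 ≤ j ∨ j + 2 ≤ i) →
      (1.5 : ℝ) < ‖y i - y j‖) ∧
  (∀ i : ℕ, 1 ≤ i → i + 1 ≤ n → ‖y (i + 1) - y i‖ ≤ (1.5 : ℝ))

/-- Assumptions on the two-body potential `v₂` and the three-body potential `v₃`. -/
structure PotentialPair (v₂ v₃ : ℝ → ℝ) : Prop where
  v₂_smooth : ContDiffOn ℝ (⊤ : ℕ∞) v₂ (Set.Ioi 0)
  v₂_lb : ∀ x ∈ Set.Ioi (0 : ℝ), (-1 : ℝ) ≤ v₂ x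
  v₂_min : v₂ 1 = -1
  v₂_min_unique : ∀ x ∈ Set.Ioi (0 : ℝ), x ≠ 1 → v₂ 1 < v₂ x
  v₂_conv : 0 < iteratedDeriv 2 v₂ 1
  v₂_mono : StrictMonoOn v₂ (Set.Ici 1)
  v₃_smooth : ContDiffOn ℝ (⊤ : ℕ∞) v₃ (Set.Icc 0 (2 * π))
  v₃_nonneg : ∀ x ∈ Set.Icc (0 : ℝ) (2 * π), 0 ≤ v₃ x
  v₃_symm : ∀ φ : ℝ, v₃ (π - φ) = v₃ (π + φ)
  v₃_min : v₃ π = 0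
  v₃_min_unique : ∀ x ∈ Set.Icc (0 : ℝ) (2 * π), x ≠ π → 0 < v₃ x
  v₃_d1 : deriv v₃ π = 0
  v₃_d2 : iteratedDeriv 2 v₃ π = 0
  v₃_d3 : iteratedDeriv 3 v₃ π = 0
  v₃_d4 : 0 < iteratedDeriv 4 v₃ π

/-- The cell energy in terms of bond lengths and angle. -/
def EcellT (v₂ v₃ : ℝ → ℝ) (ρ b₁ b₂ φ : ℝ) : ℝ :=
  v₂ b₁ + v₂ b₂ + ρ * v₂ (Real.sqrt (b₁ ^ 2 + b₂ ^ 2 - 2 * b₁ * b₂ * Real.cos φ)) + v₃ φ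

/-- The cell energy. -/
def Ecell (v₂ v₃ : ℝ → ℝ) (ρ : ℝ) (p q r : ℂ) : ℝ :=
  v₂ ‖q - p‖ + v₂ ‖r - q‖ + v₃ (ccwAngle (r - q) (p - q)) + ρ * v₂ ‖r - p‖

/-- The reduced energy `E^red_n`. -/
def Ered (v₂ v₃ : ℝ → ℝ) (ρ : ℝ) (n : ℕ) (y : ℕ → ℂ) : ℝ :=
  ∑ i ∈ Finset.Icc 2 (n - 1), Ecell v₂ v₃ ρ (y (i - 1)) (y i) (y (i + 1))

/-- `(b0, b0, π ± ψ)` are the only minimizers of the cell energy. -/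
def IsCellMinimizer (v₂ v₃ : ℝ → ℝ) (ρ b0 ψ : ℝ) : Prop :=
  0 < b0 ∧ b0 < 1 ∧ 0 < ψ ∧ ψ < π / 8 ∧
  (∀ b₁ ∈ Set.Ioi (0 : ℝ), ∀ b₂ ∈ Set.Ioi (0 : ℝ), ∀ φ ∈ Set.Icc (0 : ℝ) (2 * π),
      EcellT v₂ v₃ ρ b0 b0 (π + ψ) ≤ EcellT v₂ v₃ ρ b₁ b₂ φ) ∧
  (∀ b₁ ∈ Set.Ioi (0 : ℝ), ∀ b₂ ∈ Set.Ioi (0 : ℝ), ∀ φ ∈ Set.Icc (0 : ℝ) (2 * π),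
      EcellT v₂ v₃ ρ b₁ b₂ φ = EcellT v₂ v₃ ρ b0 b0 (π + ψ) →
        b₁ = b0 ∧ b₂ = b0 ∧ (φ = π + ψ ∨ φ = π - ψ))

/-- The minimal cell energy `e_cell`. -/
def eCell (v₂ v₃ : ℝ → ℝ) (ρ b0 ψ : ℝ) : ℝ := EcellT v₂ v₃ ρ b0 b0 (π + ψ)

/-- `y` is a minimizer of `E^red_n` over `𝒜_n`. -/
def MinimizesEred (v₂ v₃ : ℝ → ℝ) (ρ : ℝ) (n : ℕ) (y : ℕ → ℂ) : Prop :=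
  Admissible n y ∧ ∀ y' : ℕ → ℂ, Admissible n y' → Ered v₂ v₃ ρ n y ≤ Ered v₂ v₃ ρ n y'

/-- Single-period configurations `𝒰^l`, with transition index `i₀`. -/
def memU (b0 ψ : ℝ) (l i₀ : ℕ) (y : ℕ → ℂ) : Prop :=
  2 ≤ i₀ ∧ i₀ + 1 ≤ l ∧
  (∀ i : ℕ, 1 ≤ i → i ≤ l → bnd y i = b0) ∧
  (∀ i : ℕ, 2 ≤ i → i ≤ i₀ → ang y i = π - ψ) ∧
  (∀ i : ℕ, i₀ + 1 ≤ i → i ≤ l → ang y i = π + ψ)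

/-- `⌈2π/ψ̄⌉`. -/
def nceil (ψ : ℝ) : ℕ := ⌈2 * π / ψ⌉₊

/-- The maximal atomic period `l_max = 2⌈2π/ψ̄⌉ − 4`. -/
def lmaxN (ψ : ℝ) : ℕ := 2 * nceil ψ - 4

/-- `l_mid = ⌊6/ψ̄⌋`. -/
def lmidN (ψ : ℝ) : ℕ := ⌊(6 : ℝ) / ψ⌋₊

/-- The end-to-end length `λ^l(i₀)` of a single-period configuration. -/
def lambdaFn (b0 ψ : ℝ) (l i₀ : ℕ) : ℝ :=
  ‖∑ k ∈ Finset.Icc 1 l, (b0 : ℂ) * Complex.exp (Complex.I *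
      (((if k ≤ i₀ then -(((k : ℝ) - 1) * ψ) else ((k : ℝ) - 2 * (i₀ : ℝ) + 1) * ψ) : ℝ) : ℂ))‖

/-- The domain of the function `λ^l`. -/
def lambdaDom (ψ : ℝ) (l : ℕ) : Finset ℕ :=
  (Finset.Icc 2 (l - 1)).filter fun i₀ => l + 3 ≤ i₀ + nceil ψ ∧ i₀ + 2 ≤ nceil ψ

/-- `λ^l_max`, the maximum of `λ^l` over its domain. -/
def lambdaMax (b0 ψ : ℝ) (l : ℕ) : ℝ :=
  sSup (lambdaFn b0 ψ l '' ↑(lambdaDom ψ l))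

/-- `f` is affine on `s`. -/
def AffOn (f : ℝ → ℝ) (s : Set ℝ) : Prop := ∃ a b : ℝ, ∀ x ∈ s, f x = a * x + b

/-- `Lam` is the normalized wavelength `Λ`. -/
def IsNormWavelength (b0 ψ : ℝ) (Lam : ℝ → ℝ) : Prop :=
  (∀ l : ℕ, 2 ≤ l → l ≤ lmidN ψ → Even l → Lam (l : ℝ) = lambdaMax b0 ψ l / (l : ℝ)) ∧
  (∀ l : ℕ, 4 ≤ l → l ≤ lmidN ψ → Even l → AffOn Lam (Set.Icc ((l : ℝ) - 2) (l : ℝ))) ∧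
  AffOn Lam (Set.Icc ((lmidN ψ : ℝ) - 2) (lmaxN ψ : ℝ))

/-- `y ∈ 𝒰^l_δ`, with associated configuration `ybar ∈ 𝒰^l`. -/
def AssocPerturb (b0 ψ δ : ℝ) (l : ℕ) (y ybar : ℕ → ℂ) : Prop :=
  Admissible (l + 1) y ∧ (∃ i₀ : ℕ, memU b0 ψ l i₀ ybar) ∧
  (∀ i : ℕ, 1 ≤ i → i ≤ l → |bnd y i - b0| ≤ δ) ∧
  (∀ i : ℕ, 2 ≤ i → i ≤ l → |ang y i - ang ybar i| ≤ δ)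

/-- `𝒜^δ_n`. -/
def AdmissiblePerturbed (b0 ψ δ : ℝ) (n : ℕ) (y : ℕ → ℂ) : Prop :=
  Admissible n y ∧ (∀ i : ℕ, 1 ≤ i → i + 1 ≤ n → |bnd y i - b0| ≤ δ) ∧
  (∀ i : ℕ, 2 ≤ i → i + 1 ≤ n → min |ang y i - (π + ψ)| |ang y i - (π - ψ)| ≤ δ)

/-- The property of the constant `c_mix` in the length estimate for odd atomic periods. -/
def MixConst (b0 ψ c : ℝ) : Prop :=
  ∀ l₁ l₂ : ℕ, Odd l₁ → Odd l₂ → 2 ≤ l₁ → l₁ ≤ lmaxN ψ → 2 ≤ l₂ → l₂ ≤ lmaxN ψ →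
    ∀ y : ℕ → ℂ,
      (∃ i₀ : ℕ, memU b0 ψ (l₁ + 1) i₀ y) →
      (∃ i₀ : ℕ, memU b0 ψ (l₂ - 1) i₀ (fun i => y (i + l₁ + 1))) →
      (∃ m : ℤ, ang y (l₁ + 2) - π = (2 * (m : ℝ) + 1) * ψ) →
      ‖y (l₁ + l₂ + 1) - y 1‖ ≤
        max (lambdaMax b0 ψ (l₁ + 1) + lambdaMax b0 ψ (l₂ - 1))
            (lambdaMax b0 ψ (l₁ - 1) + lambdaMax b0 ψ (l₂ + 1))
          - (if l₂ ≤ l₁ then c else 0)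

/-- `𝓘_sgn`. -/
def Isgn (n : ℕ) (y : ℕ → ℂ) : Finset ℕ :=
  ((Finset.Icc 3 (n - 2)).filter fun i => π < ang y i ∧ ang y (i + 1) < π) ∪ {1}

/-- `𝓘^l_sgn`. -/
def IsgnL (n : ℕ) (y : ℕ → ℂ) (l : ℕ) : Finset ℕ :=
  (Isgn n y).filter fun i =>
    (∀ k : ℕ, 1 ≤ k → k ≤ l - 1 → i + k ∉ Isgn n y) ∧ (i + l ∈ Isgn n y ∨ i + l = n)

/-- The maximal length of odd atomic periods `ℒ`. -/
def maxOddLength (ψ : ℝ) (Lam : ℝ → ℝ) (N S : ℕ) : ℝ :=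
  sSup { x : ℝ | ∃ r : ℕ → ℕ,
    (∀ l : ℕ, r l ≠ 0 → Even l ∧ 2 ≤ l ∧ l ≤ lmaxN ψ) ∧
    (∑ l ∈ Finset.Icc 2 (lmaxN ψ), r l) = N ∧
    (∑ l ∈ Finset.Icc 2 (lmaxN ψ), l * r l) = 2 * (S / 2) ∧
    x = ∑ l ∈ Finset.Icc 2 (lmaxN ψ), (r l : ℝ) * (l : ℝ) * Lam (l : ℝ) }

/-- The generalized cell energy. -/
def EgenCell (v₂ v₃ : ℝ → ℝ) (ρ ρ' : ℝ) (p q r s : ℂ) : ℝ :=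
  (Ecell v₂ v₃ ρ p q r + Ecell v₂ v₃ ρ q r s) / 2 + ρ' * v₂ ‖s - p‖

/-- The configurational (general) energy `E_n`. -/
def Egen (v₂ v₃ : ℝ → ℝ) (ρ ρ' : ℝ) (n : ℕ) (y : ℕ → ℂ) : ℝ :=
  Ered v₂ v₃ ρ n y + ρ' * ∑ i ∈ Finset.Icc 1 (n - 3), v₂ ‖y (i + 3) - y i‖

/-- The boundary condition `(y_n − y_1)·e₁ = (n−1)μ`. -/
def BC (n : ℕ) (μ : ℝ) (y : ℕ → ℂ) : Prop := (y n - y 1).re = ((n : ℝ) - 1) * μ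

/-- The minimal energy `E^{n,μ}_min`. -/
def Emin (v₂ v₃ : ℝ → ℝ) (ρ ρ' μ : ℝ) (n : ℕ) : ℝ :=
  sInf {E : ℝ | ∃ y : ℕ → ℂ, Admissible n y ∧ BC n μ y ∧ E = Egen v₂ v₃ ρ ρ' n y} /
    ((n : ℝ) - 2)

/-- `egen` is the common value `e^gen_cell`. -/
def IsEgenCellVal (v₂ v₃ : ℝ → ℝ) (ρ ρ' egen : ℝ) : Prop :=
  ∀ n : ℕ, ∀ y : ℕ → ℂ, MinimizesEred v₂ v₃ ρ n y →
    ∀ i : ℕ, 1 ≤ i → i + 3 ≤ n →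
      Real.sign (ang y (i + 1) - π) = Real.sign (ang y (i + 2) - π) →
        EgenCell v₂ v₃ ρ ρ' (y i) (y (i + 1)) (y (i + 2)) (y (i + 3)) = egen

/-- `eper` is the common value `e_per`. -/
def IsEperVal (v₂ v₃ : ℝ → ℝ) (ρ ρ' egen eper : ℝ) : Prop :=
  ∀ n : ℕ, ∀ y : ℕ → ℂ, MinimizesEred v₂ v₃ ρ n y →
    ∀ i : ℕ, 1 ≤ i → i + 3 ≤ n →
      Real.sign (ang y (i + 1) - π) ≠ Real.sign (ang y (i + 2) - π) →
        EgenCell v₂ v₃ ρ ρ' (y i) (y (i + 1)) (y (i + 2)) (y (i + 3)) = egen + ρ' * eper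

/-- `f` is piecewise affine on `s`. -/
def PiecewiseAffOn (f : ℝ → ℝ) (s : Set ℝ) : Prop :=
  ∃ P : Finset ℝ, ∀ a b : ℝ, a ∈ s → b ∈ s → a ≤ b → (∀ z ∈ P, z ∉ Set.Ioo a b) →
    AffOn f (Set.Icc a b ∩ s)

/-- The data `(e^gen_cell, e_range, c)` from the characterization of the minimal energy. -/
def EnergyChar (v₂ v₃ : ℝ → ℝ) (ρ ρ' m₁ m₂ egen : ℝ) (erange : ℝ → ℝ) (c : ℝ) : Prop :=
  0 < c ∧ StrictMonoOn erange (Set.Icc m₁ m₂) ∧ ConvexOn ℝ (Set.Icc m₁ m₂) erange ∧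
  PiecewiseAffOn erange (Set.Icc m₁ m₂) ∧
  ∀ μ ∈ Set.Icc m₁ m₂, ∀ n : ℕ, 3 ≤ n →
    |egen + ρ' * erange μ - Emin v₂ v₃ ρ ρ' μ n| ≤ c * (ρ' ^ 2 + 1 / (n : ℝ))

/-- The set of resonant lengths `M_res`. -/
def Mres (m₁ m₂ : ℝ) (erange : ℝ → ℝ) : Set ℝ :=
  {μ | μ ∈ Set.Icc m₁ m₂ ∧ ¬ DifferentiableWithinAt ℝ erange (Set.Icc m₁ m₂) μ}

/-- `𝒞(y)`, the set of atoms where the chain changes its curvature. -/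
def Cset (n : ℕ) (y : ℕ → ℂ) : Finset ℕ :=
  (Finset.Icc 2 (n - 2)).filter fun i => π < ang y i ∧ ang y (i + 1) < π

/-- `j` is the successor of `i` in `C`. -/
def SuccIn (C : Finset ℕ) (i j : ℕ) : Prop :=
  i ∈ C ∧ j ∈ C ∧ i < j ∧ ∀ k ∈ C, i < k → j ≤ k

/-- Almost minimizers of `E^{n,μ}_min`. -/
def AlmostMin (v₂ v₃ : ℝ → ℝ) (ρ ρ' μ c : ℝ) (n : ℕ) (y : ℕ → ℂ) : Prop :=
  Admissible n y ∧ BC n μ y ∧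
    Egen v₂ v₃ ρ ρ' n y / ((n : ℝ) - 2) ≤ Emin v₂ v₃ ρ ρ' μ n + c * (ρ' ^ 2 + 1 / (n : ℝ))

/-! ### Geometry of chains -/

lemma ccw_exp {a b : ℂ} (ha : a ≠ 0) :
    b * (‖a‖ : ℂ) = a * (‖b‖ : ℂ) * Complex.exp (Complex.I * (ccwAngle a b : ℂ)) := by
  have h1 : Complex.exp (Complex.I * (ccwAngle a b : ℂ)) =
      Complex.exp ((Complex.arg (b * (starRingEnd ℂ) a) : ℂ) * Complex.I) := by
    unfold ccwAngle
    split_ifs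
    · push_cast
      rw [mul_add, Complex.exp_add]
      have : Complex.exp (Complex.I * (2 * (π : ℂ))) = 1 := by
        rw [mul_comm]; exact Complex.exp_two_pi_mul_I
      rw [this, mul_one, mul_comm]
    · rw [mul_comm]
  have h2 := Complex.norm_mul_exp_arg_mul_I (b * (starRingEnd ℂ) a)
  rw [norm_mul, Complex.norm_conj] at h2
  have hn : (‖a‖ : ℂ) ≠ 0 := by simpa using ha
  have h3 : a * (starRingEnd ℂ) a = (‖a‖ : ℂ) ^ 2 := Complex.mul_conj' a
  rw [h1]
  apply mul_right_cancel₀ hn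
  push_cast at h2
  linear_combination (-a) * h2 - b * h3

lemma ccw_mem (a b : ℂ) : 0 ≤ ccwAngle a b ∧ ccwAngle a b ≤ 2 * π := by
  unfold ccwAngle
  have h1 := Complex.neg_pi_lt_arg (b * (starRingEnd ℂ) a)
  have h2 := Complex.arg_le_pi (b * (starRingEnd ℂ) a)
  have := Real.pi_pos
  split_ifs with h
  · constructor <;> linarith
  · constructor <;> linarith

lemma v3_refl {v₂ v₃ : ℝ → ℝ} (hpot : PotentialPair v₂ v₃) (x : ℝ) : v₃ (2 * π - x) = v₃ x := by
  have := hpot.v₃_symm (x - π)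
  rw [show π - (x - π) = 2 * π - x by ring, show π + (x - π) = x by ring] at this
  exact this

lemma v3_ccw_symm {v₂ v₃ : ℝ → ℝ} (hpot : PotentialPair v₂ v₃) (a b : ℂ) :
    v₃ (ccwAngle b a) = v₃ (ccwAngle a b) := by
  have hc : a * (starRingEnd ℂ) b = (starRingEnd ℂ) (b * (starRingEnd ℂ) a) := by
    simp [mul_comm]
  unfold ccwAngle
  rw [hc, Complex.arg_conj]
  generalize Complex.arg (b * (starRingEnd ℂ) a) = t
  by_cases h : t = π
  · simp [h]
  · simp only [h, if_false]
    split_ifs with h1 h2 h2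
    · linarith
    · rw [← v3_refl hpot]; congr 1; ring
    · rw [← v3_refl hpot]; congr 1; ring
    · have : t = 0 := by linarith
      simp [this]

lemma law_cos {a b : ℂ} (ha : a ≠ 0) :
    ‖b - a‖ ^ 2 = ‖a‖ ^ 2 + ‖b‖ ^ 2 - 2 * ‖a‖ * ‖b‖ * Real.cos (ccwAngle a b) := by
  have h := ccw_exp (b := b) ha
  have hn : (‖a‖ : ℂ) ≠ 0 := by simpa using ha
  have hn' : ‖a‖ ≠ 0 := by simpa using ha
  have h3 : a * (starRingEnd ℂ) a = (‖a‖ : ℂ) ^ 2 := Complex.mul_conj' a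
  have key : (b * (starRingEnd ℂ) a).re = ‖a‖ * ‖b‖ * Real.cos (ccwAngle a b) := by
    have : b * (starRingEnd ℂ) a =
        ((‖a‖ * ‖b‖ : ℝ) : ℂ) * Complex.exp ((ccwAngle a b : ℂ) * Complex.I) := by
      apply mul_right_cancel₀ hn
      rw [mul_comm (ccwAngle a b : ℂ)]
      push_cast
      linear_combination ((starRingEnd ℂ) a) * h +
        (‖b‖ : ℂ) * Complex.exp (Complex.I * (ccwAngle a b : ℂ)) * h3
    rw [this, Complex.re_ofReal_mul, Complex.exp_ofReal_mul_I_re]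
  have h4 : ‖b - a‖ ^ 2 = ‖b‖ ^ 2 + ‖a‖ ^ 2 - 2 * (b * (starRingEnd ℂ) a).re := by
    simp only [← Complex.normSq_eq_norm_sq]
    exact Complex.normSq_sub b a
  rw [h4, key]; ring

lemma Ecell_eq {v₂ v₃ : ℝ → ℝ} (hpot : PotentialPair v₂ v₃) (ρ : ℝ) (p q r : ℂ)
    (h1 : q ≠ p) :
    Ecell v₂ v₃ ρ p q r = EcellT v₂ v₃ ρ ‖q - p‖ ‖r - q‖ (ccwAngle (p - q) (r - q)) := by
  unfold Ecell EcellT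
  have ha : p - q ≠ 0 := sub_ne_zero.2 (Ne.symm h1)
  have h := law_cos (b := r - q) ha
  rw [show r - q - (p - q) = r - p by ring, norm_sub_rev p q] at h
  rw [← h, Real.sqrt_sq (norm_nonneg _), v3_ccw_symm hpot]
  ring

lemma turn {y : ℕ → ℂ} {i : ℕ} (h : bnd y i ≠ 0) :
    (y (i + 2) - y (i + 1)) * (bnd y i : ℂ) = (y (i + 1) - y i) * (bnd y (i + 1) : ℂ) *
      Complex.exp (Complex.I * ((ang y (i + 1) - π : ℝ) : ℂ)) := by
  have ha : y i - y (i + 1) ≠ 0 := by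
    intro h0; apply h; unfold bnd; rw [norm_sub_rev, h0, norm_zero]
  have := ccw_exp (b := y (i + 2) - y (i + 1)) ha
  unfold bnd ang
  rw [norm_sub_rev (y i)] at this
  rw [show i + 1 - 1 = i by simp, show i + 1 + 1 = i + 2 by ring]
  rw [this]
  push_cast
  rw [mul_sub, Complex.exp_sub, mul_comm Complex.I (π : ℂ), Complex.exp_pi_mul_I]
  ring

lemma bond_rep {y : ℕ → ℂ} {m k : ℕ} (h : ∀ j < k, bnd y (m + j) ≠ 0) :
    ∀ j < k, (y (m + j + 1) - y (m + j)) * (bnd y m : ℂ) = (y (m + 1) - y m) *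
      ((bnd y (m + j) : ℂ) * Complex.exp (Complex.I *
        ((∑ t ∈ Finset.range j, (ang y (m + t + 1) - π) : ℝ) : ℂ))) := by
  intro j
  induction j with
  | zero => intro _; simp
  | succ j ih =>
    intro hj
    have ih' := ih (by omega)
    have ht := turn (h j (by omega))
    have hne : (bnd y (m + j) : ℂ) ≠ 0 := by exact_mod_cast h j (by omega)
    rw [Finset.sum_range_succ]
    rw [Complex.ofReal_add, mul_add, Complex.exp_add]
    rw [show m + (j + 1) + 1 = m + j + 2 by ring, show m + (j + 1) = m + j + 1 by ring]
    apply mul_right_cancel₀ hne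
    linear_combination (bnd y m : ℂ) * ht + (bnd y (m + j + 1) : ℂ) *
      Complex.exp (Complex.I * ((ang y (m + j + 1) - π : ℝ) : ℂ)) * ih'

lemma chain_norm {y : ℕ → ℂ} {m k : ℕ} (h : ∀ j < k, bnd y (m + j) ≠ 0) :
    ‖y (m + k) - y m‖ = ‖∑ j ∈ Finset.range k, ((bnd y (m + j) : ℂ) * Complex.exp (Complex.I *
        ((∑ t ∈ Finset.range j, (ang y (m + t + 1) - π) : ℝ) : ℂ)))‖ := by
  rcases Nat.eq_zero_or_pos k with rfl | hk
  · simp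
  have h0 : bnd y m ≠ 0 := h 0 hk
  have hs : y (m + k) - y m = ∑ j ∈ Finset.range k, (y (m + j + 1) - y (m + j)) := by
    have := Finset.sum_range_sub (fun j => y (m + j)) k
    simp only [add_zero] at this
    rw [← this]; rfl
  have h1 : (y (m + k) - y m) * (bnd y m : ℂ) = (y (m + 1) - y m) *
      ∑ j ∈ Finset.range k, ((bnd y (m + j) : ℂ) * Complex.exp (Complex.I *
        ((∑ t ∈ Finset.range j, (ang y (m + t + 1) - π) : ℝ) : ℂ))) := by
    rw [hs, Finset.sum_mul, Finset.mul_sum]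
    exact Finset.sum_congr rfl fun j hj => bond_rep h j (Finset.mem_range.1 hj)
  have h2 := congrArg norm h1
  rw [norm_mul, norm_mul, Complex.norm_real] at h2
  have h3 : ‖y (m + 1) - y m‖ = ‖bnd y m‖ := by unfold bnd; simp
  rw [h3, mul_comm] at h2
  exact mul_left_cancel₀ (by simpa using h0) h2

lemma exp_diff (x x' : ℝ) :
    ‖Complex.exp (Complex.I * (x : ℂ)) - Complex.exp (Complex.I * (x' : ℂ))‖ ≤ |x - x'| := by
  have : Complex.exp (Complex.I * (x : ℂ)) - Complex.exp (Complex.I * (x' : ℂ)) =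
      Complex.exp (Complex.I * (x' : ℂ)) *
        (Complex.exp (Complex.I * ((x - x' : ℝ) : ℂ)) - 1) := by
    rw [mul_sub, ← Complex.exp_add]; push_cast; ring_nf
  rw [this, norm_mul, Complex.norm_exp_I_mul_ofReal, one_mul]
  exact Real.norm_exp_I_mul_ofReal_sub_one_le

/-- comparison of end-to-end lengths of two chains -/
lemma chain_compare {y z : ℕ → ℂ} {m k : ℕ} {b0 : ℝ} (hb0 : 0 < b0) (hb1 : b0 ≤ 1)
    (h : ∀ j < k, bnd y (m + j) ≠ 0) (hz : ∀ j < k, bnd z (m + j) = b0) :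
    ‖y (m + k) - y m‖ ≤ ‖z (m + k) - z m‖ +
      ((∑ j ∈ Finset.range k, |bnd y (m + j) - b0|) +
        (k : ℝ) * ∑ t ∈ Finset.range (k - 1), |ang y (m + t + 1) - ang z (m + t + 1)|) := by
  rw [chain_norm h, chain_norm (y := z) (fun j hj => by rw [hz j hj]; exact hb0.ne')]
  rw [← sub_le_iff_le_add']
  refine (norm_sub_norm_le _ _).trans ?_
  rw [← Finset.sum_sub_distrib]
  refine (norm_sum_le _ _).trans ?_
  have hT : ∀ j ∈ Finset.range k,
      ‖(bnd y (m + j) : ℂ) * Complex.exp (Complex.I *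
        ((∑ t ∈ Finset.range j, (ang y (m + t + 1) - π) : ℝ) : ℂ)) -
       (bnd z (m + j) : ℂ) * Complex.exp (Complex.I *
        ((∑ t ∈ Finset.range j, (ang z (m + t + 1) - π) : ℝ) : ℂ))‖ ≤
      |bnd y (m + j) - b0| +
        ∑ t ∈ Finset.range (k - 1), |ang y (m + t + 1) - ang z (m + t + 1)| := by
    intro j hj
    rw [Finset.mem_range] at hj
    rw [hz j hj]
    set α := ∑ t ∈ Finset.range j, (ang y (m + t + 1) - π)
    set β := ∑ t ∈ Finset.range j, (ang z (m + t + 1) - π)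
    have h1 : (bnd y (m + j) : ℂ) * Complex.exp (Complex.I * (α : ℂ)) -
        (b0 : ℂ) * Complex.exp (Complex.I * (β : ℂ)) =
        ((bnd y (m + j) - b0 : ℝ) : ℂ) * Complex.exp (Complex.I * (α : ℂ)) +
        (b0 : ℂ) * (Complex.exp (Complex.I * (α : ℂ)) - Complex.exp (Complex.I * (β : ℂ))) := by
      push_cast; ring
    rw [h1]
    refine (norm_add_le _ _).trans ?_
    rw [norm_mul, norm_mul, Complex.norm_exp_I_mul_ofReal, mul_one, Complex.norm_real,
      Complex.norm_real, Real.norm_eq_abs, Real.norm_eq_abs, abs_of_pos hb0]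
    have h2 := exp_diff α β
    have h3 : |α - β| ≤ ∑ t ∈ Finset.range (k - 1), |ang y (m + t + 1) - ang z (m + t + 1)| := by
      have : α - β = ∑ t ∈ Finset.range j, (ang y (m + t + 1) - ang z (m + t + 1)) := by
        simp only [α, β]
        rw [← Finset.sum_sub_distrib]
        exact Finset.sum_congr rfl fun t _ => by ring
      rw [this]
      refine (Finset.abs_sum_le_sum_abs _ _).trans ?_
      apply Finset.sum_le_sum_of_subset_of_nonneg
      · intro t ht; rw [Finset.mem_range] at *; omega
      · intros; exact abs_nonneg _
    have h4 := norm_nonneg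
      (Complex.exp (Complex.I * (α : ℂ)) - Complex.exp (Complex.I * (β : ℂ)))
    nlinarith
  refine (Finset.sum_le_sum hT).trans ?_
  rw [Finset.sum_add_distrib]
  simp

/-! ### Explicit length of single-period configurations -/

lemma memU_length {b0 ψ : ℝ} {l i₀ : ℕ} {y : ℕ → ℂ} (hb0 : 0 < b0) (h : memU b0 ψ l i₀ y) :
    ‖y (l + 1) - y 1‖ = lambdaFn b0 ψ l i₀ := by
  obtain ⟨h2, hl, hb, ha, ha'⟩ := h
  have h0 : ∀ j < l, bnd y (1 + j) = b0 := fun j hj => hb _ (by omega) (by omega)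
  rw [add_comm l 1, chain_norm (fun j hj => by rw [h0 j hj]; exact hb0.ne')]
  unfold lambdaFn
  congr 1
  have : Finset.Icc 1 l = Finset.Ico 1 (l + 1) := by ext; simp
  rw [this, Finset.sum_Ico_eq_sum_range]
  simp only [Nat.add_sub_cancel]
  refine Finset.sum_congr rfl fun j hj => ?_
  rw [Finset.mem_range] at hj
  rw [h0 j hj]
  congr 4
  have hA : ∀ j < l, (∑ t ∈ Finset.range j, (ang y (1 + t + 1) - π)) =
      if 1 + j ≤ i₀ then -((((1 + j : ℕ) : ℝ) - 1) * ψ)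
      else (((1 + j : ℕ) : ℝ) - 2 * (i₀ : ℝ) + 1) * ψ := by
    intro j
    induction j with
    | zero => intro _; rw [if_pos (by omega)]; simp
    | succ j ih =>
      intro hj
      rw [Finset.sum_range_succ, ih (by omega)]
      by_cases h1 : 1 + (j + 1) ≤ i₀
      · rw [if_pos (by omega), if_pos h1, ha _ (by omega) (by omega)]
        push_cast; ring
      · rw [if_neg h1, ha' _ (by omega) (by omega)]
        by_cases h3 : 1 + j ≤ i₀
        · have : i₀ = 1 + j := by omega
          rw [if_pos h3, this]; push_cast; ring
        · rw [if_neg h3]; push_cast; ring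
  exact hA j hj

lemma two_sin_exp (α h : ℝ) : Complex.exp (Complex.I * (α : ℂ)) *
      (2 * Complex.I * (Real.sin h : ℂ)) =
    Complex.exp (Complex.I * ((α + h : ℝ) : ℂ)) - Complex.exp (Complex.I * ((α - h : ℝ) : ℂ)) := by
  have e1 : Complex.exp (Complex.I * (h : ℂ)) = Complex.cos h + Complex.sin h * Complex.I := by
    rw [mul_comm, Complex.exp_mul_I]
  have e2 : Complex.exp (Complex.I * ((-h : ℝ) : ℂ)) = Complex.cos h - Complex.sin h * Complex.I := by
    rw [mul_comm, Complex.exp_mul_I]; push_cast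
    rw [Complex.cos_neg, Complex.sin_neg]; ring
  rw [sub_eq_add_neg α h, Complex.ofReal_add, Complex.ofReal_add, mul_add, mul_add, Complex.exp_add,
    Complex.exp_add, e1, e2]
  push_cast; ring

lemma geo_sum (b0 h : ℝ) (i₀ : ℕ) (l : ℕ) (hl : i₀ ≤ l) :
    (∑ k ∈ Finset.Icc 1 l, (b0 : ℂ) * Complex.exp (Complex.I *
      (((if k ≤ i₀ then -(((k : ℝ) - 1) * (2 * h))
        else ((k : ℝ) - 2 * (i₀ : ℝ) + 1) * (2 * h)) : ℝ) : ℂ))) *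
        (2 * Complex.I * (Real.sin h : ℂ)) =
    (b0 : ℂ) * (Complex.exp (Complex.I * (h : ℂ)) -
      Complex.exp (Complex.I * ((-(2 * (i₀ : ℝ) - 1) * h : ℝ) : ℂ)) +
      Complex.exp (Complex.I * (((2 * (l : ℝ) - 4 * i₀ + 3) * h : ℝ) : ℂ)) -
      Complex.exp (Complex.I * (((3 - 2 * (i₀ : ℝ)) * h : ℝ) : ℂ))) := by
  induction l, hl using Nat.le_induction with
  | base =>
    have hA : ∀ n ≤ i₀, (∑ k ∈ Finset.Icc 1 n, (b0 : ℂ) * Complex.exp (Complex.I *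
      (((if k ≤ i₀ then -(((k : ℝ) - 1) * (2 * h))
        else ((k : ℝ) - 2 * (i₀ : ℝ) + 1) * (2 * h)) : ℝ) : ℂ))) *
        (2 * Complex.I * (Real.sin h : ℂ)) =
      (b0 : ℂ) * (Complex.exp (Complex.I * (h : ℂ)) -
        Complex.exp (Complex.I * ((-(2 * (n : ℝ) - 1) * h : ℝ) : ℂ))) := by
      intro n
      induction n with
      | zero => intro _; simp
      | succ n ih =>
        intro hn
        rw [Finset.sum_Icc_succ_top (by omega), add_mul, ih (by omega), if_pos hn, mul_assoc,
          two_sin_exp]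
        rw [show -((((n + 1 : ℕ) : ℝ) - 1) * (2 * h)) + h = -(2 * (n : ℝ) - 1) * h by push_cast; ring,
          show -((((n + 1 : ℕ) : ℝ) - 1) * (2 * h)) - h = -(2 * ((n + 1 : ℕ) : ℝ) - 1) * h by
            push_cast; ring]
        ring
    rw [hA i₀ le_rfl, show (2 * (i₀ : ℝ) - 4 * i₀ + 3) * h = (3 - 2 * (i₀ : ℝ)) * h by ring]
    ring
  | succ n hn ih =>
    rw [Finset.sum_Icc_succ_top (by omega), add_mul, ih, if_neg (by omega), mul_assoc, two_sin_exp]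
    rw [show (((n + 1 : ℕ) : ℝ) - 2 * (i₀ : ℝ) + 1) * (2 * h) + h =
        (2 * ((n + 1 : ℕ) : ℝ) - 4 * i₀ + 3) * h by ring,
      show (((n + 1 : ℕ) : ℝ) - 2 * (i₀ : ℝ) + 1) * (2 * h) - h =
        (2 * (n : ℝ) - 4 * i₀ + 3) * h by push_cast; ring]
    ring

lemma lambda_sq (b0 h : ℝ) (l i₀ : ℕ) (hl : i₀ ≤ l) :
    (lambdaFn b0 (2 * h) l i₀ * Real.sin h) ^ 2 =
      b0 ^ 2 * (Real.cos h ^ 2 + Real.cos ((2 * i₀ - 1 - l) * h) ^ 2 -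
        2 * Real.cos (l * h) * Real.cos h * Real.cos ((2 * i₀ - 1 - l) * h)) := by
  have g := geo_sum b0 h i₀ l hl
  set G := (∑ k ∈ Finset.Icc 1 l, (b0 : ℂ) * Complex.exp (Complex.I *
      (((if k ≤ i₀ then -(((k : ℝ) - 1) * (2 * h))
        else ((k : ℝ) - 2 * (i₀ : ℝ) + 1) * (2 * h)) : ℝ) : ℂ))) with hG
  have hlam : lambdaFn b0 (2 * h) l i₀ = ‖G‖ := rfl
  set u := (2 * (i₀ : ℝ) - 1 - l) * h with hu
  have e2c : ∀ x : ℝ, Complex.exp (Complex.I * (x : ℂ)) +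
      Complex.exp (Complex.I * ((-x : ℝ) : ℂ)) = 2 * (Real.cos x : ℂ) := by
    intro x
    rw [mul_comm, Complex.exp_mul_I, mul_comm Complex.I, Complex.exp_mul_I]
    push_cast
    rw [Complex.cos_neg, Complex.sin_neg]; ring
  have g2 : Complex.exp (Complex.I * (((2 * (i₀ : ℝ) - 2) * h : ℝ) : ℂ)) *
      (G * (2 * Complex.I * (Real.sin h : ℂ))) =
      (b0 : ℂ) * (2 * (Complex.exp (Complex.I * ((l * h : ℝ) : ℂ)) * (Real.cos u : ℂ) -
        (Real.cos h : ℂ))) := by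
    rw [g]
    have a1 := e2c u
    have a2 := e2c h
    have m : ∀ a b c : ℝ, a + b = c → Complex.exp (Complex.I * (a : ℂ)) *
        Complex.exp (Complex.I * (b : ℂ)) = Complex.exp (Complex.I * (c : ℂ)) := by
      intro a b c habc
      rw [← Complex.exp_add, ← habc]; push_cast; ring_nf
    have m1 := m ((2 * (i₀ : ℝ) - 2) * h) h (l * h + u) (by rw [hu]; ring)
    have m2 := m ((2 * (i₀ : ℝ) - 2) * h) (-(2 * (i₀ : ℝ) - 1) * h) (-h) (by ring)
    have m3 := m ((2 * (i₀ : ℝ) - 2) * h) ((2 * (l : ℝ) - 4 * i₀ + 3) * h) (l * h + -u)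
      (by rw [hu]; ring)
    have m4 := m ((2 * (i₀ : ℝ) - 2) * h) ((3 - 2 * (i₀ : ℝ)) * h) h (by ring)
    have m5 := m (l * h) u _ rfl
    have m6 := m (l * h) (-u) _ rfl
    linear_combination (b0 : ℂ) * (m1 - m2 + m3 - m4 - m5 - m6) - (b0 : ℂ) * a2 +
      (b0 : ℂ) * Complex.exp (Complex.I * ((l * h : ℝ) : ℂ)) * a1
  have g3 := congrArg (fun z => Complex.normSq z) g2
  simp only [Complex.normSq_eq_norm_sq] at g3
  rw [norm_mul, Complex.norm_exp_I_mul_ofReal, one_mul, norm_mul, norm_mul, norm_mul, norm_mul,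
    norm_mul] at g3
  simp only [Complex.norm_real, Complex.norm_I, Complex.norm_ofNat, mul_one] at g3
  have g4 : ‖Complex.exp (Complex.I * ((l * h : ℝ) : ℂ)) * (Real.cos u : ℂ) -
        (Real.cos h : ℂ)‖ ^ 2 = Real.cos h ^ 2 + Real.cos u ^ 2 -
        2 * Real.cos (l * h) * Real.cos h * Real.cos u := by
    rw [← Complex.normSq_eq_norm_sq, mul_comm Complex.I, Complex.exp_mul_I, Complex.normSq_apply]
    have s := Real.sin_sq_add_cos_sq (l * h)
    simp only [← Complex.ofReal_cos, ← Complex.ofReal_sin, Complex.sub_re, Complex.sub_im,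
      Complex.mul_re, Complex.mul_im, Complex.add_re, Complex.add_im, Complex.ofReal_re,
      Complex.ofReal_im, Complex.I_re, Complex.I_im]
    linear_combination (Real.cos u ^ 2) * s
  rw [mul_pow, mul_pow, mul_pow, mul_pow, g4, Real.norm_eq_abs, Real.norm_eq_abs, sq_abs, sq_abs]
    at g3
  rw [hlam, mul_pow]
  linarith

lemma lambda_nonneg (b0 ψ : ℝ) (l i : ℕ) : 0 ≤ lambdaFn b0 ψ l i := norm_nonneg _

set_option maxHeartbeats 1600000 in
lemma lambda_le {b0 ψ : ℝ} (hb0 : 0 < b0) (hψ : 0 < ψ) (hψ8 : ψ < π / 8) {l i₀ : ℕ}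
    (hev : Even l) (hi : i₀ ∈ lambdaDom ψ l) :
    lambdaFn b0 ψ l i₀ ≤ 2 * b0 * Real.cos (ψ / 2) / Real.sin (ψ / 2) * Real.sin (l * ψ / 4) := by
  unfold lambdaDom at hi
  simp only [Finset.mem_filter, Finset.mem_Icc] at hi
  obtain ⟨⟨h2, hl⟩, hN1, hN2⟩ := hi
  have hpi := Real.pi_pos
  obtain ⟨h, rfl⟩ : ∃ h, ψ = 2 * h := ⟨ψ / 2, by ring⟩
  have hh : 0 < h := by linarith
  have hN : (nceil (2 * h) : ℝ) * h < π + h := by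
    have := Nat.ceil_lt_add_one (a := 2 * π / (2 * h)) (by positivity)
    have e : 2 * π / (2 * h) * h = π := by field_simp
    unfold nceil
    nlinarith
  have c1 : (l : ℝ) + 3 ≤ i₀ + nceil (2 * h) := by exact_mod_cast hN1
  have c2 : (i₀ : ℝ) + 2 ≤ nceil (2 * h) := by exact_mod_cast hN2
  have c3 : (2 : ℝ) ≤ i₀ := by exact_mod_cast h2
  have c4 : (i₀ : ℝ) + 1 ≤ l := by exact_mod_cast (by omega : i₀ + 1 ≤ l)
  have key := lambda_sq b0 h l i₀ (by omega)
  rw [show 2 * h / 2 = h by ring]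
  have hsin : 0 < Real.sin h := Real.sin_pos_of_pos_of_lt_pi hh (by linarith)
  have hcos : 0 < Real.cos h := Real.cos_pos_of_mem_Ioo ⟨by linarith, by linarith⟩
  have hcos2 : 1 / 2 ≤ Real.cos h := by
    have := Real.one_sub_sq_div_two_le_cos (x := h)
    have : h < 1 := by linarith [Real.pi_lt_four]
    nlinarith
  have hx0 : 0 ≤ Real.sin (l * (2 * h) / 4) := by
    apply Real.sin_nonneg_of_nonneg_of_le_pi
    · positivity
    · nlinarith
  have hcc : Real.cos (l * h) ≤ Real.cos ((2 * i₀ - 1 - l) * h) := by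
    have e := Real.cos_sub_cos ((2 * i₀ - 1 - l) * h) (l * h)
    rw [show ((2 * i₀ - 1 - l) * h + l * h) / 2 = (i₀ - 1 / 2) * h by ring,
      show ((2 * i₀ - 1 - l) * h - l * h) / 2 = -((l - i₀ + 1 / 2) * h) by ring,
      Real.sin_neg] at e
    have s1 : 0 ≤ Real.sin ((i₀ - 1 / 2) * h) := by
      apply Real.sin_nonneg_of_nonneg_of_le_pi
      · apply mul_nonneg <;> linarith
      · nlinarith
    have s2 : 0 ≤ Real.sin ((l - i₀ + 1 / 2) * h) := by
      apply Real.sin_nonneg_of_nonneg_of_le_pi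
      · apply mul_nonneg <;> linarith
      · nlinarith
    nlinarith [mul_nonneg s1 s2]
  have hcu : Real.cos ((2 * i₀ - 1 - l) * h) ≤ Real.cos h := by
    obtain ⟨m, rfl⟩ := hev
    rw [← Real.cos_abs ((2 * (i₀ : ℝ) - 1 - ((m + m : ℕ) : ℝ)) * h)]
    apply Real.cos_le_cos_of_nonneg_of_le_pi hh.le
    · rw [abs_le]
      constructor <;> nlinarith
    · rw [le_abs]
      rcases Nat.lt_or_ge m i₀ with hm | hm
      · left
        have : (m : ℝ) + 1 ≤ i₀ := by exact_mod_cast hm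
        push_cast
        nlinarith
      · right
        have : (i₀ : ℝ) ≤ m := by exact_mod_cast hm
        push_cast
        nlinarith
  have hhalf : Real.cos (l * h) = 1 - 2 * Real.sin (l * (2 * h) / 4) ^ 2 := by
    have := Real.cos_two_mul (l * (2 * h) / 4)
    rw [show 2 * (l * (2 * h) / 4) = l * h by ring] at this
    have e := Real.sin_sq_add_cos_sq (l * (2 * h) / 4)
    linarith
  have hc1 := Real.cos_le_one (l * h)
  have hc2 := Real.neg_one_le_cos (l * h)
  have hc3 := Real.cos_le_one h
  have hF : Real.cos h ^ 2 + Real.cos ((2 * i₀ - 1 - l) * h) ^ 2 -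
        2 * Real.cos (l * h) * Real.cos h * Real.cos ((2 * i₀ - 1 - l) * h) ≤
      (2 * Real.cos h * Real.sin (l * (2 * h) / 4)) ^ 2 := by
    have e2 : (2 * Real.cos h * Real.sin (l * (2 * h) / 4)) ^ 2 =
        2 * Real.cos h ^ 2 * (1 - Real.cos (l * h)) := by rw [hhalf]; ring
    rw [e2]
    generalize Real.cos ((2 * i₀ - 1 - l) * h) = c at *
    generalize Real.cos (l * h) = S at *
    generalize Real.cos h = d at *
    have h3 : 0 ≤ c + d - 2 * S * d := by
      rcases le_or_gt S 0 with hS | hS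
      · nlinarith
      · nlinarith
    nlinarith [mul_nonneg h3 (sub_nonneg.2 hcu)]
  have hfin : lambdaFn b0 (2 * h) l i₀ * Real.sin h ≤
      b0 * (2 * Real.cos h * Real.sin (l * (2 * h) / 4)) := by
    rw [← pow_le_pow_iff_left₀ (mul_nonneg (lambda_nonneg _ _ _ _) hsin.le) (by positivity)
      (two_ne_zero)]
    rw [key, mul_pow b0]
    exact mul_le_mul_of_nonneg_left hF (by positivity)
  have : 2 * b0 * Real.cos h / Real.sin h * Real.sin (l * (2 * h) / 4) =
      b0 * (2 * Real.cos h * Real.sin (l * (2 * h) / 4)) / Real.sin h := by ring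
  rw [this, le_div_iff₀ hsin]
  exact hfin

lemma lambda_mid {b0 ψ : ℝ} (hb0 : 0 < b0) (hψ : 0 < ψ) (hψ8 : ψ < π / 8) {m : ℕ}
    (hm : (m : ℝ) * ψ / 2 ≤ π) :
    lambdaFn b0 ψ (m + m) m =
      2 * b0 * Real.cos (ψ / 2) / Real.sin (ψ / 2) * Real.sin (((m + m : ℕ) : ℝ) * ψ / 4) := by
  have hpi := Real.pi_pos
  obtain ⟨h, rfl⟩ : ∃ h, ψ = 2 * h := ⟨ψ / 2, by ring⟩
  have hh : 0 < h := by linarith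
  have key := lambda_sq b0 h (m + m) m (by omega)
  rw [show 2 * h / 2 = h by ring]
  have hsin : 0 < Real.sin h := Real.sin_pos_of_pos_of_lt_pi hh (by linarith)
  have hcos : 0 < Real.cos h := Real.cos_pos_of_mem_Ioo ⟨by linarith, by linarith⟩
  have e1 : ((m + m : ℕ) : ℝ) * (2 * h) / 4 = m * h := by push_cast; ring
  have e2 : (2 * (m : ℝ) - 1 - ((m + m : ℕ) : ℝ)) * h = -h := by push_cast; ring
  have e3 : ((m + m : ℕ) : ℝ) * h = 2 * (m * h) := by push_cast; ring
  rw [e2, e3, Real.cos_neg, Real.cos_two_mul] at key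
  rw [e1]
  have hs : 0 ≤ Real.sin (m * h) := by
    apply Real.sin_nonneg_of_nonneg_of_le_pi (by positivity); linarith
  have e := Real.sin_sq_add_cos_sq (m * h)
  have hfin : lambdaFn b0 (2 * h) (m + m) m * Real.sin h =
      b0 * (2 * Real.cos h * Real.sin (m * h)) := by
    rw [← sq_eq_sq₀ (mul_nonneg (lambda_nonneg _ _ _ _) hsin.le) (by positivity), key]
    linear_combination (-4 * b0 ^ 2 * Real.cos h ^ 2) * e
  rw [div_mul_eq_mul_div, eq_div_iff hsin.ne', hfin]
  ring

lemma lambdaMax_eq {b0 ψ : ℝ} (hb0 : 0 < b0) (hψ : 0 < ψ) (hψ8 : ψ < π / 8) {l : ℕ}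
    (hev : Even l) (h4 : 4 ≤ l) (hl : l ≤ lmidN ψ) :
    lambdaMax b0 ψ l =
      2 * b0 * Real.cos (ψ / 2) / Real.sin (ψ / 2) * Real.sin (l * ψ / 4) := by
  have hlr : (l : ℝ) * ψ ≤ 6 := by
    have : (l : ℝ) ≤ 6 / ψ := (Nat.le_floor_iff (by positivity)).1 hl
    rwa [le_div_iff₀ hψ] at this
  have hpi := Real.pi_gt_three
  have hN : 2 * π ≤ nceil ψ * ψ := by
    have := Nat.le_ceil (2 * π / ψ)
    rwa [div_le_iff₀ hψ] at this
  have hev' := hev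
  obtain ⟨m, rfl⟩ := hev
  have hmem : m ∈ lambdaDom ψ (m + m) := by
    unfold lambdaDom
    simp only [Finset.mem_filter, Finset.mem_Icc]
    have hk : (m : ℝ) + 3 ≤ nceil ψ := by
      by_contra hc
      push Not at hc
      push_cast at hlr
      have : π < 3.15 := Real.pi_lt_d2
      nlinarith
    have hk' : m + 3 ≤ nceil ψ := by exact_mod_cast hk
    refine ⟨⟨by omega, by omega⟩, by omega, by omega⟩
  apply IsGreatest.csSup_eq
  constructor
  · refine ⟨m, by exact_mod_cast hmem, ?_⟩
    apply lambda_mid hb0 hψ hψ8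
    push_cast at hlr; linarith
  · rintro _ ⟨i, hi, rfl⟩
    exact lambda_le hb0 hψ hψ8 hev' (by exact_mod_cast hi)

/-! ### The normalized wavelength -/

lemma le_of_deriv_nonneg {f f' : ℝ → ℝ} {a b : ℝ} (hab : a ≤ b)
    (hf : ∀ x ∈ Set.Icc a b, HasDerivAt f (f' x) x) (h0 : ∀ x ∈ Set.Icc a b, 0 ≤ f' x) :
    f a ≤ f b := by
  have hm : MonotoneOn f (Set.Icc a b) := by
    apply monotoneOn_of_deriv_nonneg (convex_Icc a b)
    · exact fun x hx => (hf x hx).continuousAt.continuousWithinAt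
    · exact fun x hx => (hf x (interior_subset hx)).differentiableAt.differentiableWithinAt
    · intro x hx
      rw [(hf x (interior_subset hx)).deriv]
      exact h0 x (interior_subset hx)
  exact hm (Set.left_mem_Icc.2 hab) (Set.right_mem_Icc.2 hab) hab

lemma sinc_hasDeriv {x : ℝ} (hx : 0 < x) :
    HasDerivAt (fun x => Real.sin x / x) ((x * Real.cos x - Real.sin x) / x ^ 2) x := by
  have := (Real.hasDerivAt_sin x).div (hasDerivAt_id x) hx.ne'
  refine HasDerivAt.congr_deriv this ?_
  simp only [id]; ring

lemma sinc_concave : ConcaveOn ℝ (Set.Ioc 0 (3 / 2 : ℝ)) (fun x => Real.sin x / x) := by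
  have hpi := Real.pi_gt_three
  apply concaveOn_of_hasDerivWithinAt2_nonpos (convex_Ioc _ _)
    (f' := fun x => (x * Real.cos x - Real.sin x) / x ^ 2)
    (f'' := fun x => (2 * Real.sin x - 2 * x * Real.cos x - x ^ 2 * Real.sin x) / x ^ 3)
  · exact fun x hx => (sinc_hasDeriv hx.1).continuousAt.continuousWithinAt
  · intro x hx
    rw [interior_Ioc] at hx
    exact (sinc_hasDeriv hx.1).hasDerivWithinAt
  · intro x hx
    rw [interior_Ioc] at hx
    apply HasDerivAt.hasDerivWithinAt
    have h1 := ((hasDerivAt_id x).mul (Real.hasDerivAt_cos x)).sub (Real.hasDerivAt_sin x)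
    have h2 := h1.div (hasDerivAt_pow 2 x) (pow_ne_zero 2 hx.1.ne')
    refine HasDerivAt.congr_deriv h2 ?_
    have := hx.1.ne'
    simp only [id, Pi.sub_apply, Pi.mul_apply]
    field_simp
    ring
  · intro x hx
    rw [interior_Ioc] at hx
    apply div_nonpos_of_nonpos_of_nonneg _ (pow_nonneg hx.1.le 3)
    have := le_of_deriv_nonneg (a := 0) (b := x)
      (f := fun x => -(2 * Real.sin x - 2 * x * Real.cos x - x ^ 2 * Real.sin x))
      (f' := fun x => x ^ 2 * Real.cos x) hx.1.le
      (by
        intro t _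
        have h1 := ((Real.hasDerivAt_sin t).const_mul 2).sub
          (((hasDerivAt_id t).const_mul 2).mul (Real.hasDerivAt_cos t))
        have h2 := (h1.sub ((hasDerivAt_pow 2 t).mul (Real.hasDerivAt_sin t))).neg
        refine HasDerivAt.congr_deriv h2 ?_
        simp only [id]
        simp)
      (by
        intro t ht
        apply mul_nonneg (sq_nonneg t)
        apply Real.cos_nonneg_of_mem_Icc
        constructor <;> linarith [ht.1, ht.2, hx.2])
    simp at this
    linarith

/-- the tangent of `sin x / x` at `3/2` -/
lemma sinc_tangent {X : ℝ} (h1 : 3 / 2 ≤ X) (h2 : X ≤ π) :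
    Real.sin X / X ≤ Real.sin (3 / 2) / (3 / 2) +
      ((3 / 2 * Real.cos (3 / 2) - Real.sin (3 / 2)) / (3 / 2) ^ 2) * (X - 3 / 2) := by
  have hp1 := Real.pi_gt_d6
  have hp2 := Real.pi_lt_d6
  set s := Real.sin (3 / 2) with hs
  set c := Real.cos (3 / 2) with hc
  have hs1 : s ≤ 1 := Real.sin_le_one _
  have hc1 : 0.07 < c := by
    have : c = Real.sin (π / 2 - 3 / 2) := by rw [Real.sin_pi_div_two_sub]
    rw [this]
    have := Real.sin_gt_sub_cube (x := π / 2 - 3 / 2) (by linarith)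
    have e1 : 0.0707 < π / 2 - 3 / 2 := by linarith
    have e2 : π / 2 - 3 / 2 < 0.0709 := by linarith
    nlinarith [pow_lt_pow_left₀ e2 (by linarith) (three_ne_zero)]
  have hc2 : c < 0.08 := by
    have : c = Real.sin (π / 2 - 3 / 2) := by rw [Real.sin_pi_div_two_sub]
    rw [this]
    have := Real.sin_lt (x := π / 2 - 3 / 2) (by linarith)
    linarith
  have hsc : s ^ 2 + c ^ 2 = 1 := Real.sin_sq_add_cos_sq _
  have hs0 : 0.9 < s := by
    have : 0 < s := Real.sin_pos_of_pos_of_lt_pi (by norm_num) (by linarith)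
    nlinarith
  set m := (3 / 2 * c - s) / (3 / 2) ^ 2 with hm
  have hm' : m = (2 / 3) * c - (4 / 9) * s := by rw [hm]; ring
  set q := -2 * m with hq
  have hq0 : 0 ≤ q := by rw [hq, hm']; linarith
  have hqs : q ≤ s := by rw [hq, hm']; linarith
  have hq1 : q ≤ 1 := by linarith
  set a := Real.arcsin q with ha
  have hsa : Real.sin a = q := Real.sin_arcsin (by linarith) hq1
  have ha0 : 0 ≤ a := Real.arcsin_nonneg.2 hq0
  have ha1 : a ≤ 3 / 2 := by
    rw [ha, Real.arcsin_le_iff_le_sin' ⟨by linarith, by linarith⟩]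
    exact hqs
  -- the auxiliary function
  set g : ℝ → ℝ := fun x => x * (s / (3 / 2) + m * (x - 3 / 2)) - Real.sin x with hg
  set g' : ℝ → ℝ := fun x => s / (3 / 2) + m * (2 * x - 3 / 2) - Real.cos x with hg'
  set g'' : ℝ → ℝ := fun x => 2 * m + Real.sin x with hg''
  have dg : ∀ x, HasDerivAt g (g' x) x := by
    intro x
    have e := ((hasDerivAt_id x).mul ((((hasDerivAt_id x).sub_const (3 / 2)).const_mul m).const_add
      (s / (3 / 2)))).sub (Real.hasDerivAt_sin x)
    refine HasDerivAt.congr_deriv e ?_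
    simp only [hg', id]; ring
  have dg' : ∀ x, HasDerivAt g' (g'' x) x := by
    intro x
    have e := (((((hasDerivAt_id x).const_mul 2).sub_const (3 / 2)).const_mul m).const_add
      (s / (3 / 2))).sub (Real.hasDerivAt_cos x)
    refine HasDerivAt.congr_deriv e ?_
    simp only [hg'']; ring
  have g0 : g (3 / 2) = 0 := by simp only [hg]; rw [← hs]; ring
  have g'0 : g' (3 / 2) = 0 := by simp only [hg']; rw [← hc, hm']; ring
  have sinlow : ∀ x, a ≤ x → x ≤ π - a → q ≤ Real.sin x := by
    intro x hx1 hx2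
    rcases le_total x (π / 2) with hx | hx
    · rw [← hsa]
      exact Real.sin_le_sin_of_le_of_le_pi_div_two (by linarith) hx hx1
    · rw [← hsa, ← Real.sin_pi_sub x]
      exact Real.sin_le_sin_of_le_of_le_pi_div_two (by linarith) (by linarith) (by linarith)
  have part1 : ∀ x, 3 / 2 ≤ x → x ≤ π - a → 0 ≤ g x := by
    intro x hx1 hx2
    rw [← g0]
    apply le_of_deriv_nonneg hx1 (fun t _ => dg t)
    intro t ht
    rw [← g'0]
    apply le_of_deriv_nonneg ht.1 (fun r _ => dg' r)
    intro r hr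
    have := sinlow r (by linarith [hr.1]) (by linarith [hr.2, ht.2])
    simp only [hg'']; linarith
  have gpi : 0 ≤ g π := by
    simp only [hg]
    rw [Real.sin_pi, sub_zero, hm']
    apply mul_nonneg (by linarith)
    nlinarith
  have gX : 0 ≤ g X := by
    rcases le_total X (π - a) with hX | hX
    · exact part1 X h1 hX
    · have hca : 3 / 2 ≤ π - a := by linarith
      have hconc : ConcaveOn ℝ (Set.Icc (π - a) π) g := by
        apply concaveOn_of_hasDerivWithinAt2_nonpos (convex_Icc _ _) (f' := g') (f'' := g'')
        · exact fun x _ => (dg x).continuousAt.continuousWithinAt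
        · exact fun x _ => (dg x).hasDerivWithinAt
        · exact fun x _ => (dg' x).hasDerivWithinAt
        · intro x hx
          have hx := interior_subset hx
          have : Real.sin x ≤ q := by
            rw [← hsa, ← Real.sin_pi_sub x]
            exact Real.sin_le_sin_of_le_of_le_pi_div_two (by linarith [hx.2]) (by linarith)
              (by linarith [hx.1])
          simp only [hg'']; linarith
      have := hconc.min_le_of_mem_Icc (x := π - a) (y := π) (z := X)
        ⟨le_rfl, by linarith⟩ ⟨by linarith, le_rfl⟩ ⟨hX, h2⟩
      exact (le_min (part1 _ hca le_rfl) gpi).trans this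
  have hX0 : 0 < X := by linarith
  rw [div_le_iff₀ hX0]
  simp only [hg] at gX
  linarith

lemma sinc_secant {x1 x2 X : ℝ} (h0 : 0 < x1) (h12 : x1 < x2) (h2 : x2 ≤ 3 / 2)
    (hX : 3 / 2 ≤ X) (hXpi : X ≤ π) :
    Real.sin X / X ≤ Real.sin x2 / x2 +
      (Real.sin x2 / x2 - Real.sin x1 / x1) / (x2 - x1) * (X - x2) := by
  have hT := sinc_tangent hX hXpi
  have hm := sinc_concave.le_slope_of_hasDerivAt (x := x1) (y := 3 / 2) ⟨h0, by linarith⟩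
    ⟨by norm_num, le_rfl⟩ (by linarith) (sinc_hasDeriv (by norm_num))
  set m := ((3 / 2 * Real.cos (3 / 2) - Real.sin (3 / 2)) / (3 / 2) ^ 2)
  rw [slope_def_field, le_div_iff₀ (by linarith)] at hm
  have hc := sinc_concave.2 (show x1 ∈ Set.Ioc (0 : ℝ) (3 / 2) from ⟨h0, by linarith⟩)
    (show (3 / 2 : ℝ) ∈ Set.Ioc (0 : ℝ) (3 / 2) from ⟨by norm_num, le_rfl⟩)
    (show 0 ≤ (3 / 2 - x2) / (3 / 2 - x1) from div_nonneg (by linarith) (by linarith))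
    (show 0 ≤ (x2 - x1) / (3 / 2 - x1) from div_nonneg (by linarith) (by linarith))
    (by have : 3 / 2 - x1 ≠ 0 := by linarith
        rw [← add_div, div_eq_one_iff_eq this]; ring)
  have e : (3 / 2 - x2) / (3 / 2 - x1) * x1 + (x2 - x1) / (3 / 2 - x1) * (3 / 2) = x2 := by
    have : 3 / 2 - x1 ≠ 0 := by linarith
    rw [div_mul_eq_mul_div, div_mul_eq_mul_div, ← add_div, div_eq_iff this]; ring
  simp only [smul_eq_mul] at hc
  rw [e] at hc
  set f1 := Real.sin x1 / x1
  set f2 := Real.sin x2 / x2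
  set fp := Real.sin (3 / 2) / (3 / 2)
  have hd : 0 < 3 / 2 - x1 := by linarith
  have hd' : 0 < x2 - x1 := by linarith
  have hc' : (3 / 2 - x2) * f1 + (x2 - x1) * fp ≤ f2 * (3 / 2 - x1) := by
    rw [← div_le_iff₀ hd]
    calc _ = _ := by ring
      _ ≤ _ := hc
  set σ := (f2 - f1) / (x2 - x1) with hσ
  have hσ' : σ * (x2 - x1) = f2 - f1 := by rw [hσ]; field_simp
  have k1 : fp ≤ f2 + σ * (3 / 2 - x2) := by
    have : 0 ≤ (x2 - x1) * (f2 + σ * (3 / 2 - x2) - fp) := by nlinarith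
    have := nonneg_of_mul_nonneg_right this hd'
    linarith
  have k2 : m ≤ σ := by
    have : m * (3 / 2 - x1) ≤ σ * (3 / 2 - x1) := by nlinarith
    exact le_of_mul_le_mul_right this hd
  nlinarith [mul_le_mul_of_nonneg_right k2 (sub_nonneg.2 hX)]

lemma wavelength_bound {b0 ψ : ℝ} (hb0 : 0 < b0) (hψ : 0 < ψ) (hψ8 : ψ < π / 8) {l : ℕ}
    (hev : Even l) (h4 : 4 ≤ l) (hl : l ≤ lmaxN ψ) {Lam : ℝ → ℝ}
    (hL : IsNormWavelength b0 ψ Lam) :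
    2 * b0 * Real.cos (ψ / 2) / Real.sin (ψ / 2) * Real.sin (l * ψ / 4) ≤ l * Lam l := by
  obtain ⟨hL1, hL2, hL3⟩ := hL
  have hpi := Real.pi_pos
  have hpi2 : π < 3.15 := Real.pi_lt_d2
  set P := 2 * b0 * Real.cos (ψ / 2) / Real.sin (ψ / 2) with hP
  have hP0 : 0 < P := by
    have : 0 < Real.sin (ψ / 2) := Real.sin_pos_of_pos_of_lt_pi (by linarith) (by linarith)
    have : 0 < Real.cos (ψ / 2) := Real.cos_pos_of_mem_Ioo ⟨by linarith, by linarith⟩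
    positivity
  have hl0 : (0 : ℝ) < l := by exact_mod_cast (by omega : 0 < l)
  rcases Nat.lt_or_ge (lmidN ψ) l with hlm | hlm
  swap
  · rw [hL1 l (by omega) hlm hev, lambdaMax_eq hb0 hψ hψ8 hev h4 hlm]
    rw [mul_div_cancel₀ _ hl0.ne']
  have h15 : 15 ≤ lmidN ψ := by
    apply Nat.le_floor
    rw [le_div_iff₀ hψ]; push_cast; linarith
  have hmid : (lmidN ψ : ℝ) * ψ ≤ 6 := by
    have := Nat.floor_le (a := 6 / ψ) (by positivity)
    rwa [le_div_iff₀ hψ] at this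
  obtain ⟨k, hk⟩ : ∃ k, lmidN ψ = 2 * k ∨ lmidN ψ = 2 * k + 1 := ⟨lmidN ψ / 2, by omega⟩
  have hk7 : 7 ≤ k := by omega
  have hLe := hL1 (2 * k) (by omega) (by omega) (even_two_mul k)
  have hLe' := hL1 (2 * (k - 1)) (by omega) (by omega) (even_two_mul _)
  rw [lambdaMax_eq hb0 hψ hψ8 (even_two_mul k) (by omega) (by omega)] at hLe
  rw [lambdaMax_eq hb0 hψ hψ8 (even_two_mul _) (by omega) (by omega)] at hLe'
  have ck : (((2 * (k - 1) : ℕ)) : ℝ) = 2 * (k : ℝ) - 2 := by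
    rw [Nat.cast_mul, Nat.cast_sub (by omega)]; push_cast; ring
  have ck2 : ((2 * k : ℕ) : ℝ) = 2 * (k : ℝ) := by push_cast; ring
  rw [ck] at hLe'
  rw [ck2] at hLe
  rw [← hP] at hLe hLe'
  have hkl : 2 * (k : ℝ) + 1 ≤ l := by exact_mod_cast (by omega : 2 * k + 1 ≤ l)
  have hlmax : (l : ℝ) ≤ (lmaxN ψ : ℝ) := by exact_mod_cast hl
  have haff : ∃ a b : ℝ, Lam (2 * (k : ℝ) - 2) = a * (2 * (k : ℝ) - 2) + b ∧
      Lam (2 * (k : ℝ)) = a * (2 * (k : ℝ)) + b ∧ Lam l = a * l + b := by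
    obtain ⟨a, b, hab⟩ := hL3
    rcases hk with hk | hk
    · have ek : (lmidN ψ : ℝ) = 2 * k := by rw [hk]; push_cast; ring
      rw [ek] at hab
      refine ⟨a, b, hab _ ⟨by linarith, by linarith⟩, hab _ ⟨by linarith, by linarith⟩,
        hab _ ⟨by linarith, by linarith⟩⟩
    · have ek : (lmidN ψ : ℝ) = 2 * k + 1 := by rw [hk]; push_cast; ring
      rw [ek] at hab
      obtain ⟨a', b', hab'⟩ := hL2 (2 * k) (by omega) (by omega) (even_two_mul k)
      rw [ck2] at hab'
      have q1 := hab (2 * (k : ℝ)) ⟨by linarith, by linarith⟩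
      have q2 := hab (2 * (k : ℝ) - 1) ⟨by linarith, by linarith⟩
      have q3 := hab' (2 * (k : ℝ)) ⟨by linarith, by linarith⟩
      have q4 := hab' (2 * (k : ℝ) - 1) ⟨by linarith, by linarith⟩
      have ea : a' = a := by linarith
      have eb : b' = b := by rw [ea] at q3; linarith
      have q5 := hab' (2 * (k : ℝ) - 2) ⟨by linarith, by linarith⟩
      rw [ea, eb] at q5
      exact ⟨a, b, q5, q1, hab _ ⟨by linarith, by linarith⟩⟩
  obtain ⟨a, b, r1, r2, r3⟩ := haff
  have hkr : (7 : ℝ) ≤ k := by exact_mod_cast hk7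
  have hX : 3 / 2 ≤ (l : ℝ) * ψ / 4 := by
    have := Nat.lt_of_floor_lt (a := 6 / ψ) hlm
    rw [div_lt_iff₀ hψ] at this
    linarith
  have hXpi : (l : ℝ) * ψ / 4 ≤ π := by
    have h1 := Nat.ceil_lt_add_one (a := 2 * π / ψ) (by positivity)
    have h2 : (l : ℝ) + 4 ≤ 2 * (nceil ψ : ℝ) := by
      unfold lmaxN at hl
      exact_mod_cast (by omega : l + 4 ≤ 2 * nceil ψ)
    have e : 2 * π / ψ * ψ = 2 * π := by field_simp
    unfold nceil at h2
    nlinarith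
  have h2k : 2 * (k : ℝ) * ψ ≤ 6 := by
    have : 2 * (k : ℝ) ≤ lmidN ψ := by exact_mod_cast (by omega : 2 * k ≤ lmidN ψ)
    nlinarith
  have hsec := sinc_secant (x1 := (2 * (k : ℝ) - 2) * ψ / 4) (x2 := 2 * (k : ℝ) * ψ / 4)
    (by apply div_pos (mul_pos (by linarith) hψ); norm_num) (by nlinarith) (by linarith) hX hXpi
  -- rescale
  have resc : ∀ t : ℝ, 0 < t → Real.sin (t * ψ / 4) / (t * ψ / 4) * (P * ψ / 4) =
      P * Real.sin (t * ψ / 4) / t := by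
    intro t ht
    field_simp
  have f1 := resc (2 * (k : ℝ) - 2) (by linarith)
  have f2 := resc (2 * (k : ℝ)) (by linarith)
  have f3 := resc l hl0
  rw [← hLe', r1] at f1
  rw [← hLe, r2] at f2
  have hfin : P * Real.sin (l * ψ / 4) / l ≤ a * l + b := by
    rw [← f3]
    have hsl : (Real.sin (2 * (k : ℝ) * ψ / 4) / (2 * (k : ℝ) * ψ / 4) -
        Real.sin ((2 * (k : ℝ) - 2) * ψ / 4) / ((2 * (k : ℝ) - 2) * ψ / 4)) /
        (2 * (k : ℝ) * ψ / 4 - (2 * (k : ℝ) - 2) * ψ / 4) * (l * ψ / 4 - 2 * (k : ℝ) * ψ / 4) *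
        (P * ψ / 4) = a * (l - 2 * k) := by
      set A := Real.sin (2 * (k : ℝ) * ψ / 4) / (2 * (k : ℝ) * ψ / 4)
      set B := Real.sin ((2 * (k : ℝ) - 2) * ψ / 4) / ((2 * (k : ℝ) - 2) * ψ / 4)
      have e1 : (A - B) * (P * ψ / 4) = 2 * a := by linarith
      have e2 : 2 * (k : ℝ) * ψ / 4 - (2 * (k : ℝ) - 2) * ψ / 4 = ψ / 2 := by ring
      rw [e2]
      calc (A - B) / (ψ / 2) * (l * ψ / 4 - 2 * (k : ℝ) * ψ / 4) * (P * ψ / 4)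
          = ((A - B) * (P * ψ / 4)) * (l - 2 * k) / 2 := by field_simp; ring
        _ = _ := by rw [e1]; ring
    have := mul_le_mul_of_nonneg_right hsec (by positivity : 0 ≤ P * ψ / 4)
    rw [add_mul, hsl, f2] at this
    linarith
  rw [r3]
  rw [div_le_iff₀ hl0] at hfin
  linarith

/-! ### Local quadratic growth of the cell energy -/

lemma taylor_lower {f : ℝ → ℝ} {x0 : ℝ} (hf : ∀ᶠ x in nhds x0, DifferentiableAt ℝ f x)
    (hf2 : DifferentiableAt ℝ (deriv f) x0) {ε : ℝ} (hε : 0 < ε) :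
    ∀ᶠ x in nhds x0, f x0 + deriv f x0 * (x - x0) + (deriv (deriv f) x0 / 2 - ε) * (x - x0) ^ 2
      ≤ f x := by
  set p := deriv f x0 with hp
  set q := deriv (deriv f) x0 with hq
  set g : ℝ → ℝ := fun x => f x - (p * (x - x0) + (q / 2 - ε) * (x - x0) ^ 2) with hg
  have dlin : ∀ x, HasDerivAt (fun x => p * (x - x0) + (q / 2 - ε) * (x - x0) ^ 2)
      (p + (q - 2 * ε) * (x - x0)) x := by
    intro x
    have h1 := (((hasDerivAt_id x).sub_const x0).const_mul p).add
      ((((hasDerivAt_id x).sub_const x0).pow 2).const_mul (q / 2 - ε))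
    refine HasDerivAt.congr_deriv h1 ?_
    simp only [id]; push_cast; ring
  have dg : ∀ᶠ x in nhds x0, deriv g x = deriv f x - (p + (q - 2 * ε) * (x - x0)) := by
    filter_upwards [hf] with x hx
    exact (hx.hasDerivAt.sub (dlin x)).deriv
  have d2 : HasDerivAt (deriv g) (q - (q - 2 * ε)) x0 := by
    refine HasDerivAt.congr_of_eventuallyEq ?_ dg
    have h1 := hf2.hasDerivAt.sub
      ((((hasDerivAt_id x0).sub_const x0).const_mul (q - 2 * ε)).const_add p)
    refine HasDerivAt.congr_deriv h1 ?_
    rw [mul_one]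
  have hmin : IsLocalMin g x0 := by
    apply isLocalMin_of_deriv_deriv_pos
    · rw [d2.deriv]; linarith
    · rw [dg.self_of_nhds, hp]; ring
    · exact (hf.self_of_nhds.hasDerivAt.sub (dlin x0)).continuousAt
  filter_upwards [hmin] with x hx
  simp only [hg] at hx
  nlinarith

lemma smooth_step {f : ℝ → ℝ} {s : Set ℝ} (hs : IsOpen s) (h : ContDiffOn ℝ (⊤ : ℕ∞) f s) :
    (∀ x ∈ s, DifferentiableAt ℝ f x) ∧ ContDiffOn ℝ (⊤ : ℕ∞) (deriv f) s := by
  have := (contDiffOn_infty_iff_deriv_of_isOpen hs).1 h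
  exact ⟨fun x hx => (this.1 x hx).differentiableAt (hs.mem_nhds hx), this.2⟩

lemma iter2 (f : ℝ → ℝ) : iteratedDeriv 2 f = deriv (deriv f) := by
  rw [iteratedDeriv_succ, iteratedDeriv_one]

lemma iter3 (f : ℝ → ℝ) : iteratedDeriv 3 f = deriv (deriv (deriv f)) := by
  rw [iteratedDeriv_succ, iter2]

lemma iter4 (f : ℝ → ℝ) : iteratedDeriv 4 f = deriv (deriv (deriv (deriv f))) := by
  rw [iteratedDeriv_succ, iter3]

lemma w_smooth {v₂ v₃ : ℝ → ℝ} (hpot : PotentialPair v₂ v₃) :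
    ContDiffOn ℝ (⊤ : ℕ∞) (fun s => v₂ (Real.sqrt s)) (Set.Ioi 0) := by
  apply hpot.v₂_smooth.comp (g := v₂) (f := Real.sqrt)
  · intro x hx
    exact (Real.contDiffAt_sqrt (ne_of_gt hx)).contDiffWithinAt
  · intro x hx
    exact Real.sqrt_pos.2 hx

lemma v3_smooth {v₂ v₃ : ℝ → ℝ} (hpot : PotentialPair v₂ v₃) :
    ContDiffOn ℝ (⊤ : ℕ∞) v₃ (Set.Ioo 0 (2 * π)) :=
  hpot.v₃_smooth.mono Set.Ioo_subset_Icc_self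

/-- the fourth-order growth of `v₃` near `π` -/
lemma v3_growth {v₂ v₃ : ℝ → ℝ} (hpot : PotentialPair v₂ v₃) :
    ∃ k ε : ℝ, 0 < k ∧ 0 < ε ∧ ∀ t, 0 < t → t < ε →
      k * t ^ 3 ≤ t * deriv (deriv v₃) (π + t) - deriv v₃ (π + t) := by
  have hpi := Real.pi_pos
  have ho : IsOpen (Set.Ioo 0 (2 * π)) := isOpen_Ioo
  obtain ⟨_, s1⟩ := smooth_step ho (v3_smooth hpot)
  obtain ⟨h1, s2⟩ := smooth_step ho s1
  obtain ⟨h2, s3⟩ := smooth_step ho s2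
  obtain ⟨h3, _⟩ := smooth_step ho s3
  have K0 := hpot.v₃_d4
  rw [iter4] at K0
  have d3 := hpot.v₃_d3
  rw [iter3] at d3
  set K := deriv (deriv (deriv (deriv v₃))) π with hK
  have hmem : π ∈ Set.Ioo 0 (2 * π) := ⟨hpi, by linarith⟩
  have hd := (h3 π hmem).hasDerivAt
  rw [hasDerivAt_iff_isLittleO] at hd
  have := hd.def (c := K / 2) (by linarith)
  rw [Metric.eventually_nhds_iff] at this
  obtain ⟨ε, hε, hh⟩ := this
  refine ⟨K / 6, min ε π, by linarith, lt_min hε hpi, ?_⟩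
  intro t ht htε
  have ht1 : t < ε := lt_of_lt_of_le htε (min_le_left _ _)
  have ht2 : t < π := lt_of_lt_of_le htε (min_le_right _ _)
  have := le_of_deriv_nonneg (a := π) (b := π + t)
    (f := fun x => (x - π) * deriv (deriv v₃) x - deriv v₃ x - K / 6 * (x - π) ^ 3)
    (f' := fun x => (x - π) * deriv (deriv (deriv v₃)) x - K / 2 * (x - π) ^ 2)
    (by linarith)
    (by
      intro x hx
      have hxm : x ∈ Set.Ioo 0 (2 * π) := ⟨by linarith [hx.1], by linarith [hx.2]⟩
      have e := (((((hasDerivAt_id x).sub_const π).mul (h2 x hxm).hasDerivAt).sub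
        (h1 x hxm).hasDerivAt)).sub ((((hasDerivAt_id x).sub_const π).pow 3).const_mul (K / 6))
      refine HasDerivAt.congr_deriv e ?_
      simp only [id]; push_cast; ring)
    (by
      intro x hx
      have hb := hh (y := x) (by
        rw [Real.dist_eq, abs_of_nonneg (by linarith [hx.1])]; linarith [hx.2])
      rw [d3, ← hK, smul_eq_mul, sub_zero, Real.norm_eq_abs, Real.norm_eq_abs,
        abs_of_nonneg (by linarith [hx.1] : 0 ≤ x - π)] at hb
      have hb' := (abs_le.1 hb).1
      have : 0 ≤ x - π := by linarith [hx.1]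
      nlinarith)
  simp only [sub_self, hpot.v₃_d1, add_sub_cancel_left] at this
  simp at this
  linarith

lemma qa_prod {b0 β1 β2 : ℝ} (hb0 : 0 < b0) (hb1 : b0 < 1) (hβ2 : |β2| ≤ 1) :
    |b0 * (β1 + β2) + β1 * β2| ≤ 2 * (|β1| + |β2|) := by
  have n1 := abs_nonneg β1
  have n2 := abs_nonneg β2
  refine (abs_add_le _ _).trans ?_
  rw [abs_mul, abs_mul, abs_of_pos hb0]
  have h1 : |β1| * |β2| ≤ |β1| := mul_le_of_le_one_right n1 hβ2
  have h2 : b0 * |β1 + β2| ≤ |β1 + β2| := mul_le_of_le_one_left (abs_nonneg _) hb1.le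
  have h3 := abs_add_le β1 β2
  linarith

lemma qa_bb {b0 β1 β2 : ℝ} (hb0 : 0 < b0) (hb1 : b0 < 1) (hβ1 : |β1| ≤ 1) (hβ2 : |β2| ≤ 1) :
    |(b0 + β1) * (b0 + β2)| ≤ 4 := by
  rw [abs_mul]
  have e1 : |b0 + β1| ≤ 2 := (abs_add_le _ _).trans (by rw [abs_of_pos hb0]; linarith)
  have e2 : |b0 + β2| ≤ 2 := (abs_add_le _ _).trans (by rw [abs_of_pos hb0]; linarith)
  calc |b0 + β1| * |b0 + β2| ≤ 2 * 2 := mul_le_mul e1 e2 (abs_nonneg _) (by norm_num)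
    _ = 4 := by norm_num

lemma qa_delta {b0 β1 β2 C d T : ℝ} (hb0 : 0 < b0) (hb1 : b0 < 1) (hβ1 : |β1| ≤ 1)
    (hβ2 : |β2| ≤ 1) (hC1 : C ≤ 1) (hC0 : 0 ≤ C) (hd : |d| ≤ 2 * T) :
    |2 * b0 * (β1 + β2) + β1 ^ 2 + β2 ^ 2 + 2 * ((b0 + β1) * (b0 + β2)) * d +
      2 * (b0 * (β1 + β2) + β1 * β2) * C| ≤ 7 * (|β1| + |β2|) + 16 * T := by
  have n1 := abs_nonneg β1
  have n2 := abs_nonneg β2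
  have e1 : |2 * b0 * (β1 + β2)| ≤ 2 * (|β1| + |β2|) := by
    rw [abs_mul, abs_of_pos (by linarith : 0 < 2 * b0)]
    exact mul_le_mul (by linarith) (abs_add_le _ _) (abs_nonneg _) (by norm_num)
  have e2 : |β1 ^ 2 + β2 ^ 2| ≤ |β1| + |β2| := by
    rw [abs_of_nonneg (by positivity), ← sq_abs β1, ← sq_abs β2]
    have h1 : |β1| * |β1| ≤ |β1| := mul_le_of_le_one_right n1 hβ1
    have h2 : |β2| * |β2| ≤ |β2| := mul_le_of_le_one_right n2 hβ2
    linarith [sq |β1|, sq |β2|]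
  have e3 : |2 * ((b0 + β1) * (b0 + β2)) * d| ≤ 16 * T := by
    rw [abs_mul, abs_mul, abs_of_pos (by norm_num : (0 : ℝ) < 2)]
    have := mul_le_mul (qa_bb hb0 hb1 hβ1 hβ2) hd (abs_nonneg _) (by norm_num)
    linarith
  have e4 : |2 * (b0 * (β1 + β2) + β1 * β2) * C| ≤ 4 * (|β1| + |β2|) := by
    rw [abs_mul, abs_mul, abs_of_pos (by norm_num : (0 : ℝ) < 2), abs_of_nonneg hC0]
    have h1 := qa_prod hb0 hb1 hβ2 (β1 := β1)
    have h2 := mul_le_of_le_one_right (abs_nonneg (b0 * (β1 + β2) + β1 * β2)) hC1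
    linarith
  have t1 := abs_add_le (2 * b0 * (β1 + β2) + (β1 ^ 2 + β2 ^ 2) + 2 * ((b0 + β1) * (b0 + β2)) * d)
    (2 * (b0 * (β1 + β2) + β1 * β2) * C)
  have t2 := abs_add_le (2 * b0 * (β1 + β2) + (β1 ^ 2 + β2 ^ 2)) (2 * ((b0 + β1) * (b0 + β2)) * d)
  have t3 := abs_add_le (2 * b0 * (β1 + β2)) (β1 ^ 2 + β2 ^ 2)
  rw [← add_assoc] at t1
  rw [← add_assoc] at t2 t3
  linarith

lemma qa_pos {A β1 β2 C : ℝ} (hA0 : 0 ≤ A) (hC1 : C ≤ 1) (hC0 : 0 ≤ C) :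
    0 ≤ A * (β1 ^ 2 + β2 ^ 2 + 2 * β1 * β2 * C) := by
  apply mul_nonneg hA0
  have : β1 ^ 2 + β2 ^ 2 + 2 * β1 * β2 * C =
    C * (β1 + β2) ^ 2 + (1 - C) * (β1 ^ 2 + β2 ^ 2) := by ring
  rw [this]
  have : 0 ≤ 1 - C := by linarith
  positivity

lemma qa_ang {A b0 C S ψ u1 u2 k τ : ℝ} (hA0 : 0 ≤ A) (hψ : 0 < ψ) (hCS : ψ * C ≤ S)
    (hu1 : u1 = A * (2 * b0 ^ 2 * S)) (hu2 : k * ψ ^ 3 ≤ ψ * u2 - u1) :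
    k / 4 * (ψ ^ 2 * τ ^ 2) ≤ (u2 / 2 - k * ψ ^ 2 / 8) * τ ^ 2 - A * b0 ^ 2 * C * τ ^ 2 -
      k * ψ ^ 2 / 8 * τ ^ 2 := by
  have e1 : ψ * (A * b0 ^ 2 * C) ≤ u1 / 2 := by
    rw [hu1]
    have := mul_le_mul_of_nonneg_left hCS (by positivity : 0 ≤ A * b0 ^ 2)
    linarith
  have e2 : k * ψ ^ 2 / 2 ≤ u2 / 2 - A * b0 ^ 2 * C := by
    have : 0 ≤ ψ * (u2 / 2 - A * b0 ^ 2 * C - k * ψ ^ 2 / 2) := by linarith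
    have := nonneg_of_mul_nonneg_right this hψ
    linarith
  have := mul_le_mul_of_nonneg_right e2 (sq_nonneg τ)
  linarith

/-- the algebra behind the quadratic growth -/
lemma quad_alg {b0 ψ κ k W ρ A C S c' β1 β2 τ u1 u2 dv1 dv2 dw du Δ : ℝ}
    (hb0 : 0 < b0) (hb1 : b0 < 1) (hψ : 0 < ψ)
    (hρ : 0 < ρ) (hW : 0 < W) (hA0 : 0 ≤ A) (hAW : A ≤ ρ * W)
    (hC1 : C ≤ 1) (hC0 : 0 ≤ C) (hS : 0 < S) (hCS : ψ * C ≤ S)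
    (hu1 : u1 = A * (2 * b0 ^ 2 * S)) (hu2 : k * ψ ^ 3 ≤ ψ * u2 - u1)
    (hρκ : 520 * (ρ * W) ≤ κ / 16) (hρk : 520 * (ρ * W) ≤ k / 8)
    (hβ1 : |β1| ≤ 1) (hβ2 : |β2| ≤ 1)
    (hΔ : Δ = 2 * b0 * (β1 + β2) + β1 ^ 2 + β2 ^ 2 + 2 * ((b0 + β1) * (b0 + β2)) * (c' - C) +
      2 * (b0 * (β1 + β2) + β1 * β2) * C)
    (a1 : -(A * (2 * b0 * (1 + C))) * β1 + κ / 4 * β1 ^ 2 ≤ dv1)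
    (a2 : -(A * (2 * b0 * (1 + C))) * β2 + κ / 4 * β2 ^ 2 ≤ dv2)
    (a3 : A * Δ - ρ * W * Δ ^ 2 ≤ dw)
    (a4 : u1 * τ + (u2 / 2 - k * ψ ^ 2 / 8) * τ ^ 2 ≤ du)
    (a5 : 2 * A * b0 ^ 2 * (-S * τ - C / 2 * τ ^ 2) - k * ψ ^ 2 / 8 * τ ^ 2 ≤
      2 * A * b0 ^ 2 * (c' - C))
    (a6 : |c' - C| ≤ 2 * (ψ * |τ|)) :
    κ / 16 * (|β1| + |β2|) ^ 2 + k / 8 * (ψ * |τ|) ^ 2 ≤ dv1 + dv2 + dw + du := by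
  set β := |β1| + |β2| with hβ
  set T := ψ * |τ| with hT
  have hT0 : 0 ≤ T := by positivity
  have hβ0 : 0 ≤ β := by positivity
  have n1 := abs_nonneg β1
  have n2 := abs_nonneg β2
  have q1 := sq_abs β1
  have q2 := sq_abs β2
  have hβsq : β ^ 2 ≤ 2 * (β1 ^ 2 + β2 ^ 2) := by
    rw [hβ, ← q1, ← q2]; have := sq_nonneg (|β1| - |β2|); linarith
  have hTsq : T ^ 2 = ψ ^ 2 * τ ^ 2 := by rw [hT, mul_pow, sq_abs]
  have hsum : |β1 + β2| ≤ β := abs_add_le _ _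
  have hprod := qa_prod hb0 hb1 hβ2 (β1 := β1)
  rw [← hβ] at hprod
  have hΔabs : |Δ| ≤ 7 * β + 16 * T := by
    rw [hΔ]; exact qa_delta hb0 hb1 hβ1 hβ2 hC1 hC0 a6
  have hΔsq : Δ ^ 2 ≤ 512 * (β ^ 2 + T ^ 2) := by
    have : Δ ^ 2 ≤ (7 * β + 16 * T) ^ 2 := by
      rw [← sq_abs Δ]; exact pow_le_pow_left₀ (abs_nonneg _) hΔabs 2
    have e2 := sq_nonneg (7 * β - 16 * T)
    have e3 := sq_nonneg β
    linarith
  have hcross : -(8 * (ρ * W) * (β * T)) ≤ 2 * A * ((b0 * (β1 + β2) + β1 * β2) * (c' - C)) := by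
    have e : |(b0 * (β1 + β2) + β1 * β2) * (c' - C)| ≤ 2 * β * (2 * T) := by
      rw [abs_mul]
      exact mul_le_mul hprod a6 (abs_nonneg _) (by linarith)
    have e1 := (abs_le.1 e).1
    have hβT : 0 ≤ β * T := mul_nonneg hβ0 hT0
    have e2 := mul_le_mul_of_nonneg_right hAW hβT
    have e3 := mul_le_mul_of_nonneg_left e1 hA0
    linarith
  have hpos := qa_pos (β1 := β1) (β2 := β2) hA0 hC1 hC0
  have hang := qa_ang (τ := τ) hA0 hψ hCS hu1 hu2
  rw [← hTsq] at hang
  have hexp : A * Δ = A * (2 * b0 * (1 + C)) * β1 + A * (2 * b0 * (1 + C)) * β2 +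
      A * (β1 ^ 2 + β2 ^ 2 + 2 * β1 * β2 * C) + 2 * A * b0 ^ 2 * (c' - C) +
      2 * A * ((b0 * (β1 + β2) + β1 * β2) * (c' - C)) := by
    rw [hΔ]; ring
  have hρW : 0 < ρ * W := by positivity
  have hB := mul_le_mul_of_nonneg_left hΔsq hρW.le
  have hβT : β * T ≤ (β ^ 2 + T ^ 2) / 2 := by have := sq_nonneg (β - T); linarith
  have hB2 := mul_le_mul_of_nonneg_left hβT hρW.le
  have hB3 := mul_le_mul_of_nonneg_right hρκ (sq_nonneg β)
  have hB4 := mul_le_mul_of_nonneg_right hρk (sq_nonneg T)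
  have hκ : 0 < κ := by linarith
  have hB5 := mul_le_mul_of_nonneg_left hβsq hκ.le
  have hu1τ : u1 * τ = 2 * A * b0 ^ 2 * (S * τ) := by rw [hu1]; ring
  have hA1 : 2 * A * b0 ^ 2 * (-S * τ - C / 2 * τ ^ 2) =
      -(2 * A * b0 ^ 2 * (S * τ)) - A * b0 ^ 2 * C * τ ^ 2 := by ring
  have hB6 : 0 ≤ ρ * W * β ^ 2 := by positivity
  have hB7 : 0 ≤ ρ * W * T ^ 2 := by positivity
  linarith
/-! ### Quadratic growth of the cell energy at its minimizers -/

lemma w_deriv_nonneg {v₂ v₃ : ℝ → ℝ} (hpot : PotentialPair v₂ v₃) {s0 : ℝ} (hs : 1 < s0) :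
    0 ≤ deriv (fun s => v₂ (Real.sqrt s)) s0 := by
  have hm : MonotoneOn (fun s => v₂ (Real.sqrt s)) (Set.Ici 1) := by
    intro a ha b hb hab
    apply hpot.v₂_mono.monotoneOn
    · exact Real.one_le_sqrt.2 ha
    · exact Real.one_le_sqrt.2 hb
    · exact Real.sqrt_le_sqrt hab
  have := hm.derivWithin_nonneg (x := s0)
  rwa [derivWithin_of_mem_nhds (Ici_mem_nhds hs)] at this

lemma cell_quad {v₂ v₃ : ℝ → ℝ} (hpot : PotentialPair v₂ v₃) {ρ b0 ψ κ k W : ℝ} (hρ : 0 < ρ)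
    (hmin : IsCellMinimizer v₂ v₃ ρ b0 ψ) (hW : 0 < W)
    (hs : 9 / 4 ≤ 2 * b0 ^ 2 * (1 + Real.cos ψ))
    (hκ : κ ≤ deriv (deriv v₂) b0)
    (hw1 : |deriv (fun s => v₂ (Real.sqrt s)) (2 * b0 ^ 2 * (1 + Real.cos ψ))| ≤ W)
    (hw2 : |deriv (deriv (fun s => v₂ (Real.sqrt s))) (2 * b0 ^ 2 * (1 + Real.cos ψ))| ≤ W)
    (hk : k * ψ ^ 3 ≤ ψ * deriv (deriv v₃) (π + ψ) - deriv v₃ (π + ψ))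
    (hρκ : 520 * (ρ * W) ≤ κ / 16) (hρk : 520 * (ρ * W) ≤ k / 8) :
    ∃ c δ : ℝ, 0 < c ∧ 0 < δ ∧ ∀ β1 β2 τ : ℝ, |β1| ≤ δ → |β2| ≤ δ → |τ| ≤ δ →
      c * (|β1| + |β2| + |τ|) ^ 2 ≤
        EcellT v₂ v₃ ρ (b0 + β1) (b0 + β2) (π + ψ + τ) - eCell v₂ v₃ ρ b0 ψ := by
  obtain ⟨hb0, hb1, hψ, hψ8, hm, -⟩ := hmin
  have hpi := Real.pi_pos
  have hρW : 0 < ρ * W := by positivity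
  have hκ0 : 0 < κ := by linarith
  have hk0 : 0 < k := by linarith
  set w : ℝ → ℝ := fun s => v₂ (Real.sqrt s) with hw
  set s0 := 2 * b0 ^ 2 * (1 + Real.cos ψ) with hs0
  set A := ρ * deriv w s0 with hA
  have hA0 : 0 ≤ A := mul_nonneg hρ.le (w_deriv_nonneg hpot (by linarith))
  have hAW : A ≤ ρ * W := mul_le_mul_of_nonneg_left ((abs_le.1 hw1).2) hρ.le
  have hC0 : 0 ≤ Real.cos ψ := Real.cos_nonneg_of_mem_Icc ⟨by linarith, by linarith⟩
  have hS0 : 0 < Real.sin ψ := Real.sin_pos_of_pos_of_lt_pi hψ (by linarith)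
  have hCS : ψ * Real.cos ψ ≤ Real.sin ψ := by
    have hcp : 0 < Real.cos ψ := Real.cos_pos_of_mem_Ioo ⟨by linarith, by linarith⟩
    have := (Real.lt_tan hψ (by linarith)).le
    rw [Real.tan_eq_sin_div_cos, le_div_iff₀ hcp] at this
    exact this
  obtain ⟨v2d, v2s⟩ := smooth_step isOpen_Ioi hpot.v₂_smooth
  obtain ⟨v2d2, -⟩ := smooth_step isOpen_Ioi v2s
  obtain ⟨wd, wss⟩ := smooth_step isOpen_Ioi (w_smooth hpot)
  obtain ⟨wd2, -⟩ := smooth_step isOpen_Ioi wss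
  obtain ⟨v3d, v3s⟩ := smooth_step isOpen_Ioo (v3_smooth hpot)
  obtain ⟨v3d2, -⟩ := smooth_step isOpen_Ioo v3s
  have hs0p : (0 : ℝ) < s0 := by linarith
  have hφ : π + ψ ∈ Set.Ioo (0 : ℝ) (2 * π) := ⟨by linarith, by linarith⟩
  have hcosπ : Real.cos (π + ψ) = -Real.cos ψ := by rw [add_comm, Real.cos_add_pi]
  have hsinπ : Real.sin (π + ψ) = -Real.sin ψ := by rw [add_comm, Real.sin_add_pi]
  have hs0e : b0 ^ 2 + b0 ^ 2 - 2 * b0 * b0 * Real.cos (π + ψ) = s0 := by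
    rw [hcosπ, hs0]; ring
  -- critical point equations
  have crit1 : deriv v₂ b0 = -(A * (2 * b0 * (1 + Real.cos ψ))) := by
    have hd1 : HasDerivAt (fun b : ℝ => b ^ 2 + b0 ^ 2 - 2 * b * b0 * Real.cos (π + ψ))
        (2 * b0 * (1 + Real.cos ψ)) b0 := by
      have := ((((hasDerivAt_id b0).pow 2).add_const (b0 ^ 2))).sub
        ((((hasDerivAt_id b0).const_mul 2).mul_const b0).mul_const (Real.cos (π + ψ)))
      refine HasDerivAt.congr_deriv this ?_
      simp only [id]; rw [hcosπ]; push_cast; ring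
    have hd2 : HasDerivAt (fun b : ℝ => w (b ^ 2 + b0 ^ 2 - 2 * b * b0 * Real.cos (π + ψ)))
        (deriv w s0 * (2 * b0 * (1 + Real.cos ψ))) b0 := by
      refine HasDerivAt.comp b0 (h₂ := w) ?_ hd1
      rw [hs0e]; exact (wd s0 hs0p).hasDerivAt
    have hd3 : HasDerivAt (fun b => EcellT v₂ v₃ ρ b b0 (π + ψ))
        (deriv v₂ b0 + ρ * (deriv w s0 * (2 * b0 * (1 + Real.cos ψ)))) b0 :=
      (((v2d b0 hb0).hasDerivAt.add_const (v₂ b0)).add (hd2.const_mul ρ)).add_const (v₃ (π + ψ))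
    have hloc : IsLocalMin (fun b => EcellT v₂ v₃ ρ b b0 (π + ψ)) b0 := by
      filter_upwards [Ioi_mem_nhds hb0] with b hb
      exact hm b hb b0 hb0 _ (Set.Ioo_subset_Icc_self hφ)
    have := hloc.hasDerivAt_eq_zero hd3
    rw [hA]; linarith
  have crit2 : deriv v₃ (π + ψ) = A * (2 * b0 ^ 2 * Real.sin ψ) := by
    have hd1 : HasDerivAt (fun φ : ℝ => b0 ^ 2 + b0 ^ 2 - 2 * b0 * b0 * Real.cos φ)
        (-(2 * b0 ^ 2 * Real.sin ψ)) (π + ψ) := by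
      have := ((Real.hasDerivAt_cos (π + ψ)).const_mul (2 * b0 * b0)).const_sub (b0 ^ 2 + b0 ^ 2)
      refine HasDerivAt.congr_deriv this ?_
      rw [hsinπ]; ring
    have hd2 : HasDerivAt (fun φ : ℝ => w (b0 ^ 2 + b0 ^ 2 - 2 * b0 * b0 * Real.cos φ))
        (deriv w s0 * (-(2 * b0 ^ 2 * Real.sin ψ))) (π + ψ) := by
      refine HasDerivAt.comp (π + ψ) (h₂ := w) ?_ hd1
      rw [hs0e]; exact (wd s0 hs0p).hasDerivAt
    have hd3 : HasDerivAt (fun φ => EcellT v₂ v₃ ρ b0 b0 φ)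
        (ρ * (deriv w s0 * (-(2 * b0 ^ 2 * Real.sin ψ))) + deriv v₃ (π + ψ)) (π + ψ) :=
      ((hd2.const_mul ρ).const_add (v₂ b0 + v₂ b0)).add (v3d _ hφ).hasDerivAt
    have hloc : IsLocalMin (fun φ => EcellT v₂ v₃ ρ b0 b0 φ) (π + ψ) := by
      filter_upwards [isOpen_Ioo.mem_nhds hφ] with φ hφ'
      exact hm b0 hb0 b0 hb0 _ (Set.Ioo_subset_Icc_self hφ')
    have := hloc.hasDerivAt_eq_zero hd3
    rw [hA]; linarith
  -- Taylor expansions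
  have t2 := taylor_lower (f := v₂) (x0 := b0) (ε := κ / 4)
    (by filter_upwards [Ioi_mem_nhds hb0] with x hx using v2d x hx) (v2d2 b0 hb0) (by linarith)
  have tw := taylor_lower (f := w) (x0 := s0) (ε := W / 2)
    (by filter_upwards [Ioi_mem_nhds hs0p] with x hx using wd x hx) (wd2 s0 hs0p) (by linarith)
  have t3 := taylor_lower (f := v₃) (x0 := π + ψ) (ε := k * ψ ^ 2 / 8)
    (by filter_upwards [isOpen_Ioo.mem_nhds hφ] with x hx using v3d x hx) (v3d2 _ hφ)
    (by positivity)
  have hAb : 0 ≤ A * b0 ^ 2 := by positivity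
  set ε' := k * ψ ^ 2 / (16 * (A * b0 ^ 2 + 1)) with hε'
  have hε'0 : 0 < ε' := by positivity
  have hε'1 : 2 * A * b0 ^ 2 * ε' ≤ k * ψ ^ 2 / 8 := by
    rw [hε', mul_div_assoc', div_le_iff₀ (by positivity)]
    have : 0 ≤ k * ψ ^ 2 := by positivity
    nlinarith
  have dcos : deriv (deriv Real.cos) ψ = -Real.cos ψ := by
    rw [Real.deriv_cos', deriv.fun_neg, Real.deriv_sin]
  have tc := taylor_lower (f := Real.cos) (x0 := ψ) (ε := ε')
    (Filter.Eventually.of_forall fun x => Real.differentiableAt_cos)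
    (by rw [Real.deriv_cos']; exact Real.differentiableAt_sin.neg) hε'0
  rw [dcos, Real.deriv_cos] at tc
  -- continuity of the squared distance
  have hcont : Filter.Tendsto (fun p : ℝ × ℝ × ℝ => (b0 + p.1) ^ 2 + (b0 + p.2.1) ^ 2 +
      2 * ((b0 + p.1) * (b0 + p.2.1)) * Real.cos (ψ + p.2.2)) (nhds (0, 0, 0)) (nhds s0) := by
    have hc : Continuous (fun p : ℝ × ℝ × ℝ => (b0 + p.1) ^ 2 + (b0 + p.2.1) ^ 2 +
      2 * ((b0 + p.1) * (b0 + p.2.1)) * Real.cos (ψ + p.2.2)) := by fun_prop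
    have := hc.tendsto (0, 0, 0)
    simp only [add_zero] at this
    rwa [show b0 ^ 2 + b0 ^ 2 + 2 * (b0 * b0) * Real.cos ψ = s0 by rw [hs0]; ring] at this
  have tw' := hcont.eventually tw
  rw [Metric.eventually_nhds_iff] at t2 t3 tc tw'
  obtain ⟨δ1, hδ1, t2⟩ := t2
  obtain ⟨δ2, hδ2, t3⟩ := t3
  obtain ⟨δ3, hδ3, tc⟩ := tc
  obtain ⟨δ4, hδ4, tw'⟩ := tw'
  have hmn : ∃ δ : ℝ, 0 < δ ∧ δ < δ1 ∧ δ < δ2 ∧ δ < δ3 ∧ δ < δ4 ∧ δ ≤ 1 ∧ δ ≤ ψ := by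
    refine ⟨min (min (min δ1 δ2) (min δ3 δ4)) (min 1 ψ) / 2, by positivity, ?_, ?_, ?_, ?_, ?_, ?_⟩
    all_goals
      have hpos : 0 < min (min (min δ1 δ2) (min δ3 δ4)) (min 1 ψ) := by positivity
      have a1 : min (min (min δ1 δ2) (min δ3 δ4)) (min 1 ψ) ≤ min (min δ1 δ2) (min δ3 δ4) :=
        min_le_left _ _
      have a2 : min (min (min δ1 δ2) (min δ3 δ4)) (min 1 ψ) ≤ min 1 ψ := min_le_right _ _
      have a3 := min_le_left (1 : ℝ) ψ
      have a4 := min_le_right (1 : ℝ) ψ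
      have a5 := min_le_left (min δ1 δ2) (min δ3 δ4)
      have a6 := min_le_right (min δ1 δ2) (min δ3 δ4)
      have a7 := min_le_left δ1 δ2
      have a8 := min_le_right δ1 δ2
      have a9 := min_le_left δ3 δ4
      have a10 := min_le_right δ3 δ4
      linarith
  obtain ⟨δ, hδ, l1, l2, l3, l4, l5, l6⟩ := hmn
  refine ⟨min (κ / 32) (k * ψ ^ 2 / 16), δ, by positivity, hδ, ?_⟩
  intro β1 β2 τ hβ1 hβ2 hτ
  have a1 := t2 (y := b0 + β1) (by rw [Real.dist_eq, add_sub_cancel_left]; linarith)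
  have a2 := t2 (y := b0 + β2) (by rw [Real.dist_eq, add_sub_cancel_left]; linarith)
  have a4 := t3 (y := π + ψ + τ) (by rw [Real.dist_eq, add_sub_cancel_left]; linarith)
  have a5 := tc (y := ψ + τ) (by rw [Real.dist_eq, add_sub_cancel_left]; linarith)
  have a3 := tw' (y := (β1, β2, τ)) (by
    rw [Prod.dist_eq, Prod.dist_eq]
    simp only [Real.dist_eq, sub_zero]
    exact max_lt (by linarith) (max_lt (by linarith) (by linarith)))
  simp only [add_sub_cancel_left] at a1 a2 a4 a5
  simp only at a3
  set s := (b0 + β1) ^ 2 + (b0 + β2) ^ 2 +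
      2 * ((b0 + β1) * (b0 + β2)) * Real.cos (ψ + τ) with hsdef
  have a6 : |Real.cos (ψ + τ) - Real.cos ψ| ≤ 2 * (ψ * |τ|) := by
    have e1 : Real.cos (ψ + τ) - Real.cos ψ = -2 * Real.sin ((ψ + τ + ψ) / 2) *
      Real.sin ((ψ + τ - ψ) / 2) := Real.cos_sub_cos _ _
    rw [e1, abs_mul, abs_mul]
    have e2 : |Real.sin ((ψ + τ + ψ) / 2)| ≤ 2 * ψ := by
      refine Real.abs_sin_le_abs.trans ?_
      have := abs_le.1 hτ
      rw [abs_le]; constructor <;> linarith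
    have e3 : |Real.sin ((ψ + τ - ψ) / 2)| ≤ |τ| / 2 := by
      refine Real.abs_sin_le_abs.trans (le_of_eq ?_)
      rw [add_sub_cancel_left, abs_div, abs_of_pos (by norm_num : (0 : ℝ) < 2)]
    have e4 := mul_le_mul e2 e3 (abs_nonneg _) (by linarith)
    rw [abs_neg, abs_of_pos (by norm_num : (0 : ℝ) < 2)]
    linarith
  have key := quad_alg (β1 := β1) (β2 := β2) (τ := τ) (c' := Real.cos (ψ + τ)) (Δ := s - s0)
    (dv1 := v₂ (b0 + β1) - v₂ b0) (dv2 := v₂ (b0 + β2) - v₂ b0)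
    (dw := ρ * (w s - w s0)) (du := v₃ (π + ψ + τ) - v₃ (π + ψ)) hb0 hb1 hψ hρ hW hA0 hAW
    (Real.cos_le_one ψ) hC0 hS0 hCS crit2 hk hρκ hρk (by linarith) (by linarith)
    (by rw [hsdef, hs0]; ring)
    (by
      rw [← crit1]
      have := mul_le_mul_of_nonneg_right hκ (sq_nonneg β1)
      linarith)
    (by
      rw [← crit1]
      have := mul_le_mul_of_nonneg_right hκ (sq_nonneg β2)
      linarith)
    (by
      have h1 := mul_le_mul_of_nonneg_right ((abs_le.1 hw2).1) (sq_nonneg (s - s0))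
      have h2 : deriv w s0 * (s - s0) - W * (s - s0) ^ 2 ≤ w s - w s0 := by linarith
      have h3 := mul_le_mul_of_nonneg_left h2 hρ.le
      rw [hA]; linarith)
    (by linarith)
    (by
      have h1 := mul_le_mul_of_nonneg_left a5 (by positivity : 0 ≤ 2 * A * b0 ^ 2)
      have h2 := mul_le_mul_of_nonneg_right hε'1 (sq_nonneg τ)
      linarith)
    a6
  have hE : EcellT v₂ v₃ ρ (b0 + β1) (b0 + β2) (π + ψ + τ) - eCell v₂ v₃ ρ b0 ψ =
      v₂ (b0 + β1) - v₂ b0 + (v₂ (b0 + β2) - v₂ b0) + ρ * (w s - w s0) +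
        (v₃ (π + ψ + τ) - v₃ (π + ψ)) := by
    unfold eCell EcellT
    rw [hs0e, show (b0 + β1) ^ 2 + (b0 + β2) ^ 2 - 2 * (b0 + β1) * (b0 + β2) *
      Real.cos (π + ψ + τ) = s by
        rw [show π + ψ + τ = (ψ + τ) + π by ring, Real.cos_add_pi, hsdef]; ring]
    simp only [hw]; ring
  rw [hE]
  refine le_trans ?_ key
  rw [mul_pow, sq_abs]
  set B := |β1| + |β2| with hB
  have hc1 := min_le_left (κ / 32) (k * ψ ^ 2 / 16)
  have hc2 := min_le_right (κ / 32) (k * ψ ^ 2 / 16)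
  have hc0 : 0 ≤ min (κ / 32) (k * ψ ^ 2 / 16) := by positivity
  have g1 := mul_le_mul_of_nonneg_right hc1 (sq_nonneg B)
  have g2 := mul_le_mul_of_nonneg_right hc2 (sq_nonneg τ)
  have g3 : (B + |τ|) ^ 2 ≤ 2 * (B ^ 2 + τ ^ 2) := by
    rw [← sq_abs τ]
    have := sq_nonneg (B - |τ|)
    linarith
  have g4 := mul_le_mul_of_nonneg_left g3 hc0
  linarith

lemma EcellT_mirror {v₂ v₃ : ℝ → ℝ} (hpot : PotentialPair v₂ v₃) (ρ b₁ b₂ ψ τ : ℝ) :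
    EcellT v₂ v₃ ρ b₁ b₂ (π - ψ + τ) = EcellT v₂ v₃ ρ b₁ b₂ (π + ψ + -τ) := by
  unfold EcellT
  have h1 : v₃ (π - ψ + τ) = v₃ (π + ψ + -τ) := by
    have := hpot.v₃_symm (ψ - τ)
    rw [show π - ψ + τ = π - (ψ - τ) by ring, this]; ring_nf
  have h2 : Real.cos (π - ψ + τ) = Real.cos (π + ψ + -τ) := by
    rw [show π - ψ + τ = π - (ψ - τ) by ring, show π + ψ + -τ = (ψ - τ) + π by ring,
      Real.cos_pi_sub, Real.cos_add_pi]
  rw [h1, h2]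
/-- choice of the smallness threshold for `ρ` -/
lemma rho_choice {v₂ v₃ : ℝ → ℝ} (hpot : PotentialPair v₂ v₃) :
    ∃ ρ₀ : ℝ, 0 < ρ₀ ∧ ∀ ρ : ℝ, 0 < ρ → ρ ≤ ρ₀ → ∀ b0 ψ : ℝ, IsCellMinimizer v₂ v₃ ρ b0 ψ →
      9 / 4 ≤ 2 * b0 ^ 2 * (1 + Real.cos ψ) →
      ∃ c δ : ℝ, 0 < c ∧ 0 < δ ∧ ∀ β1 β2 τ : ℝ, |β1| ≤ δ → |β2| ≤ δ → |τ| ≤ δ →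
        c * (|β1| + |β2| + |τ|) ^ 2 ≤
          EcellT v₂ v₃ ρ (b0 + β1) (b0 + β2) (π + ψ + τ) - eCell v₂ v₃ ρ b0 ψ := by
  have hpi := Real.pi_pos
  obtain ⟨v2d, v2s⟩ := smooth_step isOpen_Ioi hpot.v₂_smooth
  obtain ⟨v2d2, v2s2⟩ := smooth_step isOpen_Ioi v2s
  obtain ⟨v2d3, -⟩ := smooth_step isOpen_Ioi v2s2
  obtain ⟨wd, wss⟩ := smooth_step isOpen_Ioi (w_smooth hpot)
  obtain ⟨wd2, wss2⟩ := smooth_step isOpen_Ioi wss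
  have conv := hpot.v₂_conv
  rw [iter2] at conv
  set κ := deriv (deriv v₂) 1 / 2 with hκ
  have hκ0 : 0 < κ := by positivity
  have hev : ∀ᶠ x in nhds (1 : ℝ), κ < deriv (deriv v₂) x :=
    (v2d3 1 (by norm_num)).continuousAt.eventually (lt_mem_nhds (by linarith))
  rw [Metric.eventually_nhds_iff] at hev
  obtain ⟨ε1, hε1, hev⟩ := hev
  obtain ⟨k, ε2, hk, hε2, hgr⟩ := v3_growth hpot
  obtain ⟨W1, hW1⟩ := (isCompact_Icc (a := (9 / 4 : ℝ)) (b := 4)).exists_bound_of_continuousOn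
    (f := deriv (fun s => v₂ (Real.sqrt s)))
    (wss.continuousOn.mono fun x hx => lt_of_lt_of_le (by norm_num) hx.1)
  obtain ⟨W2, hW2⟩ := (isCompact_Icc (a := (9 / 4 : ℝ)) (b := 4)).exists_bound_of_continuousOn
    (f := deriv (deriv (fun s => v₂ (Real.sqrt s))))
    (wss2.continuousOn.mono fun x hx => lt_of_lt_of_le (by norm_num) hx.1)
  obtain ⟨m1, hm1, hm1'⟩ := (isCompact_Icc (a := (3 / 4 : ℝ)) (b := 1 - ε1)).exists_forall_le'
    (f := fun x => v₂ x + 1) (a := 0)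
    ((hpot.v₂_smooth.continuousOn.mono fun x hx => lt_of_lt_of_le (by norm_num) hx.1).add
      continuousOn_const)
    (by
      intro x hx
      have := hpot.v₂_min_unique x (lt_of_lt_of_le (by norm_num) hx.1)
        (by have := hx.2; intro h; linarith)
      rw [hpot.v₂_min] at this; linarith)
  obtain ⟨m2, hm2, hm2'⟩ := (isCompact_Icc (a := π + ε2) (b := π + π / 8)).exists_forall_le'
    (f := v₃) (a := 0)
    (hpot.v₃_smooth.continuousOn.mono fun x hx => ⟨by linarith [hx.1], by linarith [hx.2]⟩)
    (by
      intro x hx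
      exact hpot.v₃_min_unique x ⟨by linarith [hx.1], by linarith [hx.2]⟩
        (by have := hx.1; intro h; linarith))
  set W := |W1| + |W2| + 1 with hW
  have hW0 : 0 < W := by positivity
  have h22 : 0 < 2 + v₂ 2 := by
    have := hpot.v₂_lb 2 (by norm_num : (0 : ℝ) < 2); linarith
  set ρ₀ := min (min (m1 / (2 + v₂ 2)) (m2 / (2 + v₂ 2))) (min (κ / (8320 * W)) (k / (4160 * W)))
    with hρ₀
  have r1 : ρ₀ ≤ m1 / (2 + v₂ 2) := (min_le_left _ _).trans (min_le_left _ _)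
  have r2 : ρ₀ ≤ m2 / (2 + v₂ 2) := (min_le_left _ _).trans (min_le_right _ _)
  have r3 : ρ₀ ≤ κ / (8320 * W) := (min_le_right _ _).trans (min_le_left _ _)
  have r4 : ρ₀ ≤ k / (4160 * W) := (min_le_right _ _).trans (min_le_right _ _)
  refine ⟨ρ₀, by positivity, ?_⟩
  intro ρ hρ hρle b0 ψ hmin hs
  have hmin' := hmin
  obtain ⟨hb0, hb1, hψ, hψ8, hm, -⟩ := hmin
  have q1 := hρle.trans r1
  have q2 := hρle.trans r2
  have q3 := hρle.trans r3
  have q4 := hρle.trans r4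
  rw [le_div_iff₀ (by positivity)] at q1 q2 q3 q4
  have hC1 := Real.cos_le_one ψ
  have hb34 : 3 / 4 ≤ b0 := by
    by_contra h
    push Not at h
    have : b0 ^ 2 < (3 / 4) ^ 2 := pow_lt_pow_left₀ h hb0.le (by norm_num)
    nlinarith [mul_le_mul_of_nonneg_left hC1 (sq_nonneg b0)]
  have hs4 : 2 * b0 ^ 2 * (1 + Real.cos ψ) ≤ 4 := by
    have : b0 ^ 2 ≤ 1 := by nlinarith
    nlinarith [mul_le_mul_of_nonneg_left hC1 (sq_nonneg b0)]
  have hcmp : 2 * (v₂ b0 + 1) + v₃ (π + ψ) ≤ ρ * (1 + v₂ 2) := by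
    have h1 := hm 1 (by norm_num : (0 : ℝ) < 1) 1 (by norm_num : (0 : ℝ) < 1) π
      ⟨hpi.le, by linarith⟩
    unfold EcellT at h1
    rw [Real.cos_pi, hpot.v₂_min, hpot.v₃_min] at h1
    have e : Real.sqrt (1 ^ 2 + 1 ^ 2 - 2 * 1 * 1 * -1) = 2 := by
      rw [show (1 : ℝ) ^ 2 + 1 ^ 2 - 2 * 1 * 1 * -1 = 2 ^ 2 by norm_num]
      exact Real.sqrt_sq (by norm_num)
    rw [e] at h1
    have h2 := hpot.v₂_lb (Real.sqrt (b0 ^ 2 + b0 ^ 2 - 2 * b0 * b0 * Real.cos (π + ψ)))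
      (Real.sqrt_pos.2 (by rw [add_comm π, Real.cos_add_pi]; linarith))
    have h3 := mul_le_mul_of_nonneg_left h2 hρ.le
    linarith
  have hv3 := hpot.v₃_nonneg (π + ψ) ⟨by linarith, by linarith⟩
  have hv2 := hpot.v₂_lb b0 hb0
  have hbε : 1 - ε1 < b0 := by
    by_contra h
    push Not at h
    have := hm1' b0 ⟨hb34, h⟩
    linarith
  have hψε : ψ < ε2 := by
    by_contra h
    push Not at h
    have := hm2' (π + ψ) ⟨by linarith, by linarith⟩
    linarith
  apply cell_quad hpot (κ := κ) (k := k) (W := W) hρ hmin' hW0 hs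
  · exact (hev (y := b0) (by rw [Real.dist_eq, abs_lt]; constructor <;> linarith)).le
  · have := hW1 _ ⟨hs, hs4⟩
    rw [Real.norm_eq_abs] at this
    linarith [le_abs_self W1, abs_nonneg W2]
  · have := hW2 _ ⟨hs, hs4⟩
    rw [Real.norm_eq_abs] at this
    linarith [le_abs_self W2, abs_nonneg W1]
  · exact hgr ψ hψ hψε
  · linarith
  · linarith
/-! ### Circular arcs and the final estimate -/

lemma arc_sum (b0 θ : ℝ) (k : ℕ) :
    (∑ j ∈ Finset.range k, (b0 : ℂ) * Complex.exp (Complex.I * ((j * θ : ℝ) : ℂ))) *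
        (2 * Complex.I * (Real.sin (θ / 2) : ℂ)) =
    (b0 : ℂ) * (Complex.exp (Complex.I * (((k : ℝ) * θ - θ / 2 : ℝ) : ℂ)) -
      Complex.exp (Complex.I * ((-(θ / 2) : ℝ) : ℂ))) := by
  induction k with
  | zero => simp
  | succ k ih =>
    rw [Finset.sum_range_succ, add_mul, ih, mul_assoc (b0 : ℂ), two_sin_exp,
      show (((k + 1 : ℕ) : ℝ) * θ - θ / 2) = k * θ + θ / 2 by push_cast; ring]
    ring

lemma arc_length {z : ℕ → ℂ} {m k : ℕ} {b0 θ : ℝ} (hb0 : 0 < b0)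
    (hz : ∀ j < k, bnd z (m + j) = b0) (ha : ∀ t, t + 1 < k → ang z (m + t + 1) - π = θ) :
    ‖z (m + k) - z m‖ * |Real.sin (θ / 2)| = b0 * |Real.sin (k * θ / 2)| := by
  rw [chain_norm (fun j hj => by rw [hz j hj]; exact hb0.ne')]
  have e : (∑ j ∈ Finset.range k, ((bnd z (m + j) : ℂ) * Complex.exp (Complex.I *
        ((∑ t ∈ Finset.range j, (ang z (m + t + 1) - π) : ℝ) : ℂ)))) =
      ∑ j ∈ Finset.range k, (b0 : ℂ) * Complex.exp (Complex.I * ((j * θ : ℝ) : ℂ)) := by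
    refine Finset.sum_congr rfl fun j hj => ?_
    rw [Finset.mem_range] at hj
    have e2 : (∑ t ∈ Finset.range j, (ang z (m + t + 1) - π)) = j * θ := by
      rw [Finset.sum_congr rfl (g := fun _ => θ)
        (fun t ht => ha t (by have := Finset.mem_range.1 ht; omega))]
      simp
    rw [hz j hj, e2]
  rw [e]
  have h1 := arc_sum b0 θ k
  have h2 := two_sin_exp (((k : ℝ) - 1) * θ / 2) (k * θ / 2)
  rw [show ((k : ℝ) - 1) * θ / 2 + k * θ / 2 = k * θ - θ / 2 by ring,
    show ((k : ℝ) - 1) * θ / 2 - k * θ / 2 = -(θ / 2) by ring] at h2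
  rw [← h2] at h1
  have h3 := congrArg norm h1
  simp only [norm_mul, Complex.norm_exp_I_mul_ofReal, Complex.norm_real, Complex.norm_I,
    Complex.norm_ofNat, mul_one, one_mul, Real.norm_eq_abs, abs_of_pos hb0] at h3
  linarith

lemma perturb_length {y z : ℕ → ℂ} {m k : ℕ} {b0 δ : ℝ} (hb0 : 0 < b0) (hb1 : b0 ≤ 1)
    (hδ0 : 0 < δ) (hδ : δ < b0) (hz : ∀ j < k, bnd z (m + j) = b0)
    (hy : ∀ j < k, |bnd y (m + j) - b0| ≤ δ)
    (ha : ∀ t, t + 1 < k → |ang y (m + t + 1) - ang z (m + t + 1)| ≤ δ) :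
    ‖y (m + k) - y m‖ ≤ ‖z (m + k) - z m‖ + (k + (k : ℝ) ^ 2) * δ := by
  have h0 : ∀ j < k, bnd y (m + j) ≠ 0 := by
    intro j hj h
    have := hy j hj
    rw [h, zero_sub, abs_neg, abs_of_pos hb0] at this
    linarith
  have hc := chain_compare hb0 hb1 h0 hz
  have s1 : (∑ j ∈ Finset.range k, |bnd y (m + j) - b0|) ≤ k * δ := by
    have := Finset.sum_le_card_nsmul (Finset.range k) (fun j => |bnd y (m + j) - b0|) δ
      (fun j hj => hy j (Finset.mem_range.1 hj))
    simpa using this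
  have s2 : (∑ t ∈ Finset.range (k - 1), |ang y (m + t + 1) - ang z (m + t + 1)|) ≤ k * δ := by
    have := Finset.sum_le_card_nsmul (Finset.range (k - 1))
      (fun t => |ang y (m + t + 1) - ang z (m + t + 1)|) δ
      (fun j hj => ha j (by have := Finset.mem_range.1 hj; omega))
    rw [Finset.card_range, nsmul_eq_mul] at this
    refine this.trans (mul_le_mul_of_nonneg_right ?_ hδ0.le)
    exact_mod_cast Nat.sub_le k 1
  have s3 := mul_le_mul_of_nonneg_left s2 (Nat.cast_nonneg (α := ℝ) k)
  have : (k + (k : ℝ) ^ 2) * δ = k * δ + k * (k * δ) := by ring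
  linarith

lemma ang_cases {b0 ψ : ℝ} {l i₀ : ℕ} {z : ℕ → ℂ} (h : memU b0 ψ l i₀ z) {i : ℕ} (h2 : 2 ≤ i)
    (hl : i ≤ l) : ang z i = π - ψ ∨ ang z i = π + ψ := by
  obtain ⟨-, -, -, h1, h3⟩ := h
  by_cases hi : i ≤ i₀
  · exact Or.inl (h1 i h2 hi)
  · exact Or.inr (h3 i (by omega) hl)

/-- the first inequality -/
lemma energy_lower {v₂ v₃ : ℝ → ℝ} (hpot : PotentialPair v₂ v₃) {ρ b0 ψ c δ : ℝ}
    (hb0 : 0 < b0) (hb1 : b0 < 1) (hc : 0 < c) (hδ : δ < b0)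
    (hq : ∀ β1 β2 τ : ℝ, |β1| ≤ δ → |β2| ≤ δ → |τ| ≤ δ →
        c * (|β1| + |β2| + |τ|) ^ 2 ≤
          EcellT v₂ v₃ ρ (b0 + β1) (b0 + β2) (π + ψ + τ) - eCell v₂ v₃ ρ b0 ψ)
    {l : ℕ} (hl2 : 2 ≤ l) {M : ℝ} (hM : (l : ℝ) ^ 3 ≤ M)
    {y z : ℕ → ℂ} (h : AssocPerturb b0 ψ δ l y z) :
    c / (M + 1) * max (‖y (l + 1) - y 1‖ - ‖z (l + 1) - z 1‖) 0 ^ 2 ≤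
      Ered v₂ v₃ ρ (l + 1) y - ((l : ℝ) - 1) * eCell v₂ v₃ ρ b0 ψ := by
  obtain ⟨-, ⟨i₀, hU⟩, hb, ha⟩ := h
  obtain ⟨n, rfl⟩ : ∃ n, l = n + 1 := ⟨l - 1, by omega⟩
  have hzb := hU.2.2.1
  have hne : ∀ i, 1 ≤ i → i ≤ n + 1 → bnd y i ≠ 0 := by
    intro i h1 h2 h0
    have := hb i h1 h2
    rw [h0, zero_sub, abs_neg, abs_of_pos hb0] at this
    linarith
  set x : ℕ → ℝ := fun t => |bnd y (t + 1) - b0| + |bnd y (t + 2) - b0| +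
    |ang y (t + 2) - ang z (t + 2)| with hx
  have hx0 : ∀ t, 0 ≤ x t := fun t => by positivity
  -- energy
  have hE : c * ∑ t ∈ Finset.range n, x t ^ 2 ≤
      Ered v₂ v₃ ρ (n + 1 + 1) y - (((n + 1 : ℕ) : ℝ) - 1) * eCell v₂ v₃ ρ b0 ψ := by
    have e1 : Ered v₂ v₃ ρ (n + 1 + 1) y = ∑ t ∈ Finset.range n,
        EcellT v₂ v₃ ρ (bnd y (t + 1)) (bnd y (t + 2)) (ang y (t + 2)) := by
      unfold Ered
      have : Finset.Icc 2 (n + 1 + 1 - 1) = Finset.Ico 2 (n + 2) := by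
        ext; simp only [Finset.mem_Icc, Finset.mem_Ico]; omega
      rw [this, Finset.sum_Ico_eq_sum_range]
      simp only [Nat.add_sub_cancel]
      refine Finset.sum_congr rfl fun t ht => ?_
      rw [Finset.mem_range] at ht
      rw [show 2 + t - 1 = t + 1 by omega, show 2 + t = t + 2 by omega, Ecell_eq hpot]
      · rfl
      · intro h0
        apply hne (t + 1) (by omega) (by omega)
        unfold bnd
        rw [show t + 1 + 1 = t + 2 by omega, h0, sub_self, norm_zero]
    have e2 : (((n + 1 : ℕ) : ℝ) - 1) * eCell v₂ v₃ ρ b0 ψ =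
        ∑ t ∈ Finset.range n, eCell v₂ v₃ ρ b0 ψ := by simp
    rw [e1, e2, ← Finset.sum_sub_distrib, Finset.mul_sum]
    refine Finset.sum_le_sum fun t ht => ?_
    rw [Finset.mem_range] at ht
    have b1 := hb (t + 1) (by omega) (by omega)
    have b2 := hb (t + 2) (by omega) (by omega)
    have b3 := ha (t + 2) (by omega) (by omega)
    rcases ang_cases hU (i := t + 2) (by omega) (by omega) with hh | hh
    · have := hq (bnd y (t + 1) - b0) (bnd y (t + 2) - b0) (-(ang y (t + 2) - ang z (t + 2)))
        b1 b2 (by rwa [abs_neg])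
      rw [← EcellT_mirror hpot, abs_neg, hh] at this
      simp only [add_sub_cancel] at this
      simp only [hx, hh]
      exact this
    · have := hq (bnd y (t + 1) - b0) (bnd y (t + 2) - b0) (ang y (t + 2) - ang z (t + 2))
        b1 b2 b3
      rw [hh] at this
      simp only [add_sub_cancel] at this
      simp only [hx, hh]
      exact this
  -- length
  have hL : ‖y (n + 1 + 1) - y 1‖ - ‖z (n + 1 + 1) - z 1‖ ≤
      ((n + 1 : ℕ) : ℝ) * ∑ t ∈ Finset.range n, x t := by
    have hc := chain_compare (m := 1) (k := n + 1) (y := y) (z := z) hb0 hb1.le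
      (fun j hj => hne _ (by omega) (by omega)) (fun j hj => hzb _ (by omega) (by omega))
    rw [show 1 + (n + 1) = n + 1 + 1 by omega, Finset.sum_range_succ', Nat.add_sub_cancel] at hc
    have f1 : |bnd y (1 + 0) - b0| ≤ ∑ t ∈ Finset.range n, |bnd y (t + 1) - b0| :=
      Finset.single_le_sum (f := fun t => |bnd y (t + 1) - b0|) (fun t _ => abs_nonneg _)
        (Finset.mem_range.2 (by omega : 0 < n))
    have f2 : ∑ t ∈ Finset.range n, |bnd y (1 + (t + 1)) - b0| =
        ∑ t ∈ Finset.range n, |bnd y (t + 2) - b0| :=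
      Finset.sum_congr rfl fun t _ => by rw [show 1 + (t + 1) = t + 2 by omega]
    have f3 : ∑ t ∈ Finset.range n, |ang y (1 + t + 1) - ang z (1 + t + 1)| =
        ∑ t ∈ Finset.range n, |ang y (t + 2) - ang z (t + 2)| :=
      Finset.sum_congr rfl fun t _ => by rw [show 1 + t + 1 = t + 2 by omega]
    have f4 : ∑ t ∈ Finset.range n, x t = ∑ t ∈ Finset.range n, |bnd y (t + 1) - b0| +
        ∑ t ∈ Finset.range n, |bnd y (t + 2) - b0| +
        ∑ t ∈ Finset.range n, |ang y (t + 2) - ang z (t + 2)| := by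
      rw [← Finset.sum_add_distrib, ← Finset.sum_add_distrib]
    rw [f2, f3] at hc
    have g1 : 0 ≤ ∑ t ∈ Finset.range n, |bnd y (t + 1) - b0| :=
      Finset.sum_nonneg fun _ _ => abs_nonneg _
    have g2 : 0 ≤ ∑ t ∈ Finset.range n, |bnd y (t + 2) - b0| :=
      Finset.sum_nonneg fun _ _ => abs_nonneg _
    have g3 := mul_nonneg (Nat.cast_nonneg (α := ℝ) n) (add_nonneg g1 g2)
    rw [f4]
    push_cast at hc ⊢
    linarith
  have hX0 : 0 ≤ ∑ t ∈ Finset.range n, x t := Finset.sum_nonneg fun t _ => hx0 t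
  have hCS : (∑ t ∈ Finset.range n, x t) ^ 2 ≤ n * ∑ t ∈ Finset.range n, x t ^ 2 := by
    have := sq_sum_le_card_mul_sum_sq (s := Finset.range n) (f := x)
    rwa [Finset.card_range] at this
  have hmax : max (‖y (n + 1 + 1) - y 1‖ - ‖z (n + 1 + 1) - z 1‖) 0 ≤
      ((n + 1 : ℕ) : ℝ) * ∑ t ∈ Finset.range n, x t :=
    max_le hL (by positivity)
  have hsq := pow_le_pow_left₀ (le_max_right _ _) hmax 2
  set Q := ∑ t ∈ Finset.range n, x t ^ 2 with hQ
  have hQ0 : 0 ≤ Q := Finset.sum_nonneg fun t _ => sq_nonneg _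
  have h3 : (((n + 1 : ℕ) : ℝ) * ∑ t ∈ Finset.range n, x t) ^ 2 ≤ M * Q := by
    rw [mul_pow]
    have a1 := mul_le_mul_of_nonneg_left hCS (sq_nonneg ((n + 1 : ℕ) : ℝ))
    have a2 := mul_le_mul_of_nonneg_right hM hQ0
    have a3 : ((n + 1 : ℕ) : ℝ) ^ 2 * (n * Q) ≤ ((n + 1 : ℕ) : ℝ) ^ 3 * Q := by
      have : 0 ≤ ((n + 1 : ℕ) : ℝ) ^ 2 * Q := by positivity
      have e : ((n + 1 : ℕ) : ℝ) ^ 3 * Q = ((n + 1 : ℕ) : ℝ) ^ 2 * (n * Q) +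
        ((n + 1 : ℕ) : ℝ) ^ 2 * Q := by push_cast; ring
      linarith
    linarith
  have hM0 : 0 ≤ M := le_trans (by positivity) hM
  refine le_trans ?_ hE
  calc c / (M + 1) * max (‖y (n + 1 + 1) - y 1‖ - ‖z (n + 1 + 1) - z 1‖) 0 ^ 2
      ≤ c / (M + 1) * (M * Q) :=
        mul_le_mul_of_nonneg_left (hsq.trans h3) (by positivity)
    _ ≤ c / (M + 1) * ((M + 1) * Q) :=
        mul_le_mul_of_nonneg_left (by linarith) (by positivity)
    _ = c * Q := by field_simp

/-- a full turn of either arc is incompatible with admissibility -/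
lemma arc_contra {b0 ψ δ : ℝ} (hb0 : 0 < b0) (hb1 : b0 < 1) (hψ : 0 < ψ) (hψ8 : ψ < π / 8)
    (hδ0 : 0 < δ) (hδ : δ < b0) (hδN : (nceil ψ : ℝ) ^ 2 * δ ≤ 1 / 2) {l m : ℕ} {σ : ℝ}
    (hσ : σ = 1 ∨ σ = -1) {y z : ℕ → ℂ} (hadm : Admissible (l + 1) y)
    (hm : 1 ≤ m) (hml : m + (nceil ψ - 1) ≤ l + 1)
    (hz : ∀ i, 1 ≤ i → i ≤ l → bnd z i = b0) (hy : ∀ i, 1 ≤ i → i ≤ l → |bnd y i - b0| ≤ δ)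
    (hay : ∀ i, 2 ≤ i → i ≤ l → |ang y i - ang z i| ≤ δ)
    (haz : ∀ t, t + 1 < nceil ψ - 1 → ang z (m + t + 1) = π + σ * ψ) : False := by
  have hpi := Real.pi_pos
  have hN1 : 2 * π ≤ nceil ψ * ψ := by
    have := Nat.le_ceil (2 * π / ψ)
    rwa [div_le_iff₀ hψ] at this
  have hN2 : nceil ψ * ψ < 2 * π + ψ := by
    have := Nat.ceil_lt_add_one (a := 2 * π / ψ) (by positivity)
    rw [← sub_lt_iff_lt_add, lt_div_iff₀ hψ] at this
    unfold nceil
    linarith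
  have hN3 : 3 ≤ nceil ψ := by
    by_contra h
    have : (nceil ψ : ℝ) ≤ 2 := by exact_mod_cast (by omega : nceil ψ ≤ 2)
    nlinarith
  obtain ⟨k, hk⟩ : ∃ k, nceil ψ = k + 1 := ⟨nceil ψ - 1, by omega⟩
  rw [hk, Nat.add_sub_cancel] at hml haz
  rw [hk] at hN1 hN2 hδN
  push_cast at hN1 hN2 hδN
  have hs2 : 0 < Real.sin (ψ / 2) := Real.sin_pos_of_pos_of_lt_pi (by linarith) (by linarith)
  have hp := perturb_length (y := y) (z := z) (m := m) (k := k) hb0 hb1.le hδ0 hδ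
    (fun j hj => hz _ (by omega) (by omega)) (fun j hj => hy _ (by omega) (by omega))
    (fun t ht => hay _ (by omega) (by omega))
  have hl := arc_length (z := z) (m := m) (k := k) (θ := σ * ψ) hb0
    (fun j hj => hz _ (by omega) (by omega)) (fun t ht => by rw [haz t ht]; ring)
  have habs : ∀ u : ℝ, |Real.sin (σ * u)| = |Real.sin u| := by
    intro u
    rcases hσ with rfl | rfl
    · rw [one_mul]
    · rw [neg_one_mul, Real.sin_neg, abs_neg]
  rw [show σ * ψ / 2 = σ * (ψ / 2) by ring, show (k : ℝ) * (σ * ψ) / 2 = σ * (k * ψ / 2) by ring,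
    habs, habs, abs_of_pos hs2] at hl
  have hsk : |Real.sin (k * ψ / 2)| ≤ Real.sin (ψ / 2) := by
    rw [← Real.sin_pi_sub (k * ψ / 2), abs_of_nonneg
      (Real.sin_nonneg_of_nonneg_of_le_pi (by linarith) (by linarith))]
    exact Real.sin_le_sin_of_le_of_le_pi_div_two (by linarith) (by linarith) (by linarith)
  have hz1 : ‖z (m + k) - z m‖ ≤ b0 := by
    have h1 := mul_le_mul_of_nonneg_left hsk hb0.le
    rw [← hl] at h1
    exact le_of_mul_le_mul_right h1 hs2
  have ha := hadm.1 (m + k) m (by omega) (by omega) hm (by omega) (Or.inr (by omega))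
  have hkδ : 0 ≤ (k + 1 : ℝ) * δ := by positivity
  have e : ((k : ℝ) + 1) ^ 2 * δ = (k + (k : ℝ) ^ 2) * δ + (k + 1 : ℝ) * δ := by ring
  norm_num at ha
  linarith

lemma dom_mem {b0 ψ δ : ℝ} (hb0 : 0 < b0) (hb1 : b0 < 1) (hψ : 0 < ψ) (hψ8 : ψ < π / 8)
    (hδ0 : 0 < δ) (hδ : δ < b0) (hδN : (nceil ψ : ℝ) ^ 2 * δ ≤ 1 / 2) {l i₀ : ℕ}
    {y z : ℕ → ℂ} (hadm : Admissible (l + 1) y) (hU : memU b0 ψ l i₀ z)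
    (hy : ∀ i, 1 ≤ i → i ≤ l → |bnd y i - b0| ≤ δ)
    (hay : ∀ i, 2 ≤ i → i ≤ l → |ang y i - ang z i| ≤ δ) : i₀ ∈ lambdaDom ψ l := by
  obtain ⟨h2, hl, hz, a1, a2⟩ := hU
  unfold lambdaDom
  rw [Finset.mem_filter, Finset.mem_Icc]
  refine ⟨⟨h2, by omega⟩, ?_, ?_⟩
  · by_contra h
    exact arc_contra hb0 hb1 hψ hψ8 hδ0 hδ hδN (σ := 1) (m := i₀) (Or.inl rfl) hadm (by omega)
      (by omega) hz hy hay (fun t ht => by rw [a2 _ (by omega) (by omega)]; ring)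
  · by_contra h
    exact arc_contra hb0 hb1 hψ hψ8 hδ0 hδ hδN (σ := -1) (m := 1) (Or.inr rfl) hadm (by omega)
      (by omega) hz hy hay (fun t ht => by rw [a1 _ (by omega) (by omega)]; ring)

/-- if the minimal cell is too short there are no admissible perturbations -/
lemma short_contra {b0 ψ δ : ℝ} (hb0 : 0 < b0) (hb1 : b0 < 1) (hψ : 0 < ψ) (hψ8 : ψ < π / 8)
    (hδ0 : 0 < δ) (hδ : δ < b0) (hδs : 2 * b0 * Real.cos (ψ / 2) + 6 * δ ≤ 3 / 2) {l : ℕ}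
    {y z : ℕ → ℂ} (h : AssocPerturb b0 ψ δ l y z) : False := by
  have hpi := Real.pi_pos
  obtain ⟨hadm, ⟨i₀, h2, hl, hz, a1, a2⟩, hy, hay⟩ := h
  have hs2 : 0 < Real.sin (ψ / 2) := Real.sin_pos_of_pos_of_lt_pi (by linarith) (by linarith)
  have hp := perturb_length (y := y) (z := z) (m := 1) (k := 2) hb0 hb1.le hδ0 hδ
    (fun j hj => hz _ (by omega) (by omega)) (fun j hj => hy _ (by omega) (by omega))
    (fun t ht => hay _ (by omega) (by omega))
  have hL := arc_length (z := z) (m := 1) (k := 2) (θ := -ψ) hb0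
    (fun j hj => hz _ (by omega) (by omega))
    (fun t ht => by rw [a1 _ (by omega) (by omega)]; ring)
  rw [neg_div, Real.sin_neg, abs_neg, abs_of_pos hs2,
    show ((2 : ℕ) : ℝ) * (-ψ) / 2 = -(2 * (ψ / 2)) by push_cast; ring, Real.sin_neg, abs_neg,
    Real.sin_two_mul, abs_of_nonneg (by
      have := Real.cos_nonneg_of_mem_Icc (x := ψ / 2) ⟨by linarith, by linarith⟩
      positivity)] at hL
  have e : ‖z (1 + 2) - z 1‖ = 2 * b0 * Real.cos (ψ / 2) := by
    have : ‖z (1 + 2) - z 1‖ * Real.sin (ψ / 2) = 2 * b0 * Real.cos (ψ / 2) * Real.sin (ψ / 2) := by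
      rw [hL]; ring
    exact mul_right_cancel₀ hs2.ne' this
  have ha := hadm.1 (1 + 2) 1 (by omega) (by omega) le_rfl (by omega) (Or.inr (by omega))
  rw [e] at hp
  norm_num at ha hp
  linarith
/-- the energy excess controls the length excess. -/
theorem energy_excess_controls_length (v₂ v₃ : ℝ → ℝ) (hpot : PotentialPair v₂ v₃) :
    ∃ ρ₀ : ℝ, 0 < ρ₀ ∧ ∀ ρ : ℝ, 0 < ρ → ρ ≤ ρ₀ →
      ∀ b0 ψ : ℝ, IsCellMinimizer v₂ v₃ ρ b0 ψ →
        ∃ δ₀ C : ℝ, 0 < δ₀ ∧ 0 < C ∧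
          ∀ δ : ℝ, 0 < δ → δ ≤ δ₀ →
            ∀ l : ℕ, Even l → 2 ≤ l → l ≤ lmaxN ψ →
              ∀ y ybar : ℕ → ℂ, AssocPerturb b0 ψ δ l y ybar →
                ∀ Lam : ℝ → ℝ, IsNormWavelength b0 ψ Lam →
                  C * max (‖y (l + 1) - y 1‖ - ‖ybar (l + 1) - ybar 1‖) 0 ^ 2 ≤
                      Ered v₂ v₃ ρ (l + 1) y - ((l : ℝ) - 1) * eCell v₂ v₃ ρ b0 ψ ∧
                  C * max (‖y (l + 1) - y 1‖ - (l : ℝ) * Lam (l : ℝ)) 0 ^ 2 ≤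
                      Ered v₂ v₃ ρ (l + 1) y - ((l : ℝ) - 1) * eCell v₂ v₃ ρ b0 ψ := by
  obtain ⟨ρ₀, hρ₀, hch⟩ := rho_choice hpot
  refine ⟨ρ₀, hρ₀, ?_⟩
  intro ρ hρ hρle b0 ψ hmin
  have hmin' := hmin
  obtain ⟨hb0, hb1, hψ, hψ8, -, -⟩ := hmin'
  have hpi := Real.pi_pos
  have hc2 : 0 < Real.cos (ψ / 2) := Real.cos_pos_of_mem_Ioo ⟨by linarith, by linarith⟩
  have hdbl : Real.cos ψ = 2 * Real.cos (ψ / 2) ^ 2 - 1 := by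
    rw [← Real.cos_two_mul]; congr 1; ring
  by_cases hs : 9 / 4 ≤ 2 * b0 ^ 2 * (1 + Real.cos ψ)
  · obtain ⟨c, δq, hc, hδq, hq⟩ := hch ρ hρ hρle b0 ψ hmin hs
    refine ⟨min δq (min (b0 / 2) (1 / (2 * ((nceil ψ : ℝ) ^ 2 + 1)))),
      c / ((lmaxN ψ : ℝ) ^ 3 + 1), by positivity, by positivity, ?_⟩
    intro δ hδ0 hδ l hev hl2 hlmax y z hP Lam hLam
    have d1 : δ ≤ δq := hδ.trans (min_le_left _ _)
    have d2 : δ ≤ b0 / 2 := hδ.trans ((min_le_right _ _).trans (min_le_left _ _))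
    have d3 : δ ≤ 1 / (2 * ((nceil ψ : ℝ) ^ 2 + 1)) :=
      hδ.trans ((min_le_right _ _).trans (min_le_right _ _))
    have hδb : δ < b0 := by linarith
    have hδN : (nceil ψ : ℝ) ^ 2 * δ ≤ 1 / 2 := by
      rw [le_div_iff₀ (by positivity)] at d3
      linarith
    have h1 := energy_lower hpot hb0 hb1 hc hδb
      (fun β1 β2 τ a b d => hq β1 β2 τ (a.trans d1) (b.trans d1) (d.trans d1)) hl2
      (M := (lmaxN ψ : ℝ) ^ 3) (pow_le_pow_left₀ (by positivity) (by exact_mod_cast hlmax) 3) hP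
    refine ⟨h1, le_trans ?_ h1⟩
    obtain ⟨hadm, ⟨i₀, hU⟩, hy, hay⟩ := hP
    have h4 : 4 ≤ l := by
      have g1 := hU.1
      have g2 := hU.2.1
      obtain ⟨r, hr⟩ := hev
      omega
    have hdom := dom_mem hb0 hb1 hψ hψ8 hδ0 hδb hδN hadm hU hy hay
    have hlen : ‖z (l + 1) - z 1‖ ≤ (l : ℝ) * Lam l := by
      rw [memU_length hb0 hU]
      exact (lambda_le hb0 hψ hψ8 hev hdom).trans
        (wavelength_bound hb0 hψ hψ8 hev h4 hlmax hLam)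
    refine mul_le_mul_of_nonneg_left ?_ (by positivity)
    exact pow_le_pow_left₀ (le_max_right _ _) (max_le_max (by linarith) le_rfl) 2
  · push Not at hs
    have hlt : 2 * b0 * Real.cos (ψ / 2) < 3 / 2 := by
      apply lt_of_pow_lt_pow_left₀ 2 (by norm_num)
      rw [hdbl] at hs
      have e : (2 * b0 * Real.cos (ψ / 2)) ^ 2 =
        2 * b0 ^ 2 * (1 + (2 * Real.cos (ψ / 2) ^ 2 - 1)) := by ring
      rw [e]; norm_num; linarith
    refine ⟨min (b0 / 2) ((3 / 2 - 2 * b0 * Real.cos (ψ / 2)) / 6), 1,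
      lt_min (by linarith) (by linarith), one_pos, ?_⟩
    intro δ hδ0 hδ l hev hl2 hlmax y z hP Lam hLam
    have d1 : δ ≤ b0 / 2 := hδ.trans (min_le_left _ _)
    have d2 : δ ≤ (3 / 2 - 2 * b0 * Real.cos (ψ / 2)) / 6 := hδ.trans (min_le_right _ _)
    exact (short_contra hb0 hb1 hψ hψ8 hδ0 (by linarith) (by linarith) hP).elim

end
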